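/- arXiv:1901.03617 — 5 statements merged into one kernel-verified Lean document; each statement's English description precedes it below -/
import Mathlib

section
/- Let G be a countable group and μ a finitely supported probability measure on G whose support generates G. If the random walk (G,μ) is ℓ¹-noise sensitive, then (G,μ) is Liouville: every bounded μ-harmonic function on G is constant. -/
open Filter

namespace NS

/-- A probability measure on a countable (discrete) set, as a nonnegative
function summing to 1. -/
def IsProbMeasure {E : Type*} (ξ : E → ℝ) : Prop :=
  (∀ x, 0 ≤ ξ x) ∧ ∑' x, ξ x = 1

/-- Convolution of two measures on a group. -/
noncomputable def conv {G : Type*} [Group G] (μ ν : G → ℝ) : G → ℝ :=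
  fun g => ∑' h, μ h * ν (h⁻¹ * g)

/-- `convPow μ n` is the `n`-fold convolution `μ^{*n}`, the law of the random
walk at time `n` (with `μ^{*0}` the Dirac mass at the identity). -/
noncomputable def convPow {G : Type*} [Group G] (μ : G → ℝ) : ℕ → G → ℝ
  | 0 => ({1} : Set G).indicator (fun _ => (1 : ℝ))
  | n + 1 => conv μ (convPow μ n)

/-- The diagonal measure `μ^diag` on `G × G`. -/
noncomputable def diagM {G : Type*} [Group G] (μ : G → ℝ) : G × G → ℝ :=
  {p : G × G | p.1 = p.2}.indicator (fun p => μ p.1)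

/-- Product of two measures. -/
def prodM {G H : Type*} (μ : G → ℝ) (ν : H → ℝ) : G × H → ℝ :=
  fun p => μ p.1 * ν p.2

/-- The noise kernel `π^ρ = (1-ρ)·μ^diag + ρ·(μ×μ)` on `G × G`. -/
noncomputable def noise {G : Type*} [Group G] (μ : G → ℝ) (ρ : ℝ) : G × G → ℝ :=
  fun p => (1 - ρ) * diagM μ p + ρ * prodM μ μ p

/-- The `ℓ¹` distance between two measures. -/
noncomputable def l1dist {E : Type*} (ξ₁ ξ₂ : E → ℝ) : ℝ :=
  ∑' x, |ξ₁ x - ξ₂ x|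

/-- `(G,μ)` is `ℓ¹`-noise sensitive. -/
def L1NoiseSensitive {G : Type*} [Group G] (μ : G → ℝ) : Prop :=
  ∀ ρ ∈ Set.Ioo (0 : ℝ) 1,
    Tendsto
      (fun n => l1dist (convPow (noise μ ρ) n) (prodM (convPow μ n) (convPow μ n)))
      atTop (nhds 0)

/-- Shannon entropy of a measure. -/
noncomputable def entropy {E : Type*} (ξ : E → ℝ) : ℝ :=
  -∑' x, ξ x * Real.log (ξ x)

/-- `(G,μ)` is entropy noise sensitive: `H(Y_n^ρ | X_n) / H(X_n) → 1`, where
`H(Y_n^ρ | X_n) = H(π_n^ρ) - H(μ_n)`. -/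
def EntropyNoiseSensitive {G : Type*} [Group G] (μ : G → ℝ) : Prop :=
  ∀ ρ ∈ Set.Ioo (0 : ℝ) 1,
    Tendsto
      (fun n => (entropy (convPow (noise μ ρ) n) - entropy (convPow μ n))
        / entropy (convPow μ n))
      atTop (nhds 1)

/-- A function is `μ`-harmonic. -/
def Harmonic {G : Type*} [Group G] (μ : G → ℝ) (f : G → ℝ) : Prop :=
  ∀ y, f y = ∑' x, μ x * f (y * x)

/-- `(G,μ)` is Liouville: every bounded `μ`-harmonic function is constant. -/
def Liouville {G : Type*} [Group G] (μ : G → ℝ) : Prop :=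
  ∀ f : G → ℝ, Harmonic μ f → (∃ C, ∀ g, |f g| ≤ C) → ∀ x y, f x = f y

/-- Word distance for a generating set `S`: least length of a word in `S`
evaluating to `x⁻¹ * y`. -/
noncomputable def wordDist {G : Type*} [Group G] (S : Set G) (x y : G) : ℕ :=
  sInf {n : ℕ | ∃ w : List G, w.length = n ∧ (∀ g ∈ w, g ∈ S) ∧ w.prod = x⁻¹ * y}

/-- Expected distance `E d(X_n, X'_n)` between two independent samples of law `ξ`. -/
noncomputable def spread {G : Type*} [Group G] (S : Set G) (ξ : G → ℝ) : ℝ :=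
  ∑' p : G × G, ξ p.1 * ξ p.2 * (wordDist S p.1 p.2 : ℝ)

/-- Expected distance between the two coordinates under a measure on `G × G`. -/
noncomputable def avgDist {G : Type*} [Group G] (S : Set G) (π : G × G → ℝ) : ℝ :=
  ∑' p : G × G, π p * (wordDist S p.1 p.2 : ℝ)

/-- `ν` is a coupling of `ξ₁` and `ξ₂`. -/
def IsCoupling {E₁ E₂ : Type*} (ν : E₁ × E₂ → ℝ) (ξ₁ : E₁ → ℝ) (ξ₂ : E₂ → ℝ) : Prop :=
  (∀ p, 0 ≤ ν p) ∧ (∀ x, ∑' y, ν (x, y) = ξ₁ x) ∧ (∀ y, ∑' x, ν (x, y) = ξ₂ y)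

/-- `U^s(ξ₁,ξ₂)`: infimum over couplings `ν` of `ν(d(x,y) ≥ s)`. -/
noncomputable def Ufn {E₁ E₂ : Type*} (d : E₁ → E₂ → ℝ) (s : ℝ)
    (ξ₁ : E₁ → ℝ) (ξ₂ : E₂ → ℝ) : ℝ :=
  sInf {r : ℝ | ∃ ν : E₁ × E₂ → ℝ, IsCoupling ν ξ₁ ξ₂ ∧
    r = ∑' p : E₁ × E₂, {q : E₁ × E₂ | s ≤ d q.1 q.2}.indicator ν p}

/-- The `ℓ¹` product metric on `G × G` associated to the word metric of `S`. -/
noncomputable def wordDistProd {G : Type*} [Group G] (S : Set G) :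
    G × G → G × G → ℝ :=
  fun p q => (wordDist S p.1 q.1 : ℝ) + (wordDist S p.2 q.2 : ℝ)

/-- The Markov operator of `π` (with support in `S`). -/
noncomputable def mop {H : Type*} [Group H] (S : Finset H) (π : H → ℝ) :
    Module.End ℝ (H → ℝ) where
  toFun h := fun z => ∑ q ∈ S, π q * h (z * q)
  map_add' a b := by
    funext z
    simp [mul_add, Finset.sum_add_distrib]
  map_smul' c a := by
    funext z
    simp only [Pi.smul_apply, smul_eq_mul, RingHom.id_apply, Finset.mul_sum]
    exact Finset.sum_congr rfl fun _ _ => by ring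

lemma mop_apply {H : Type*} [Group H] (S : Finset H) (π : H → ℝ) (h : H → ℝ) (z : H) :
    mop S π h z = ∑ q ∈ S, π q * h (z * q) := rfl

lemma convPow_succ_apply {H : Type*} [Group H] (S : Finset H) (π : H → ℝ)
    (hS : ∀ x, x ∉ S → π x = 0) (n : ℕ) (g : H) :
    convPow π (n + 1) g = ∑ h ∈ S, π h * convPow π n (h⁻¹ * g) := by
  change ∑' h, π h * convPow π n (h⁻¹ * g) = _
  exact tsum_eq_sum fun b hb => by simp [hS b hb]

lemma convPow_finite {H : Type*} [Group H] (S : Finset H) (π : H → ℝ)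
    (hS : ∀ x, x ∉ S → π x = 0) (n : ℕ) : (Function.support (convPow π n)).Finite := by
  induction n with
  | zero =>
    refine (Set.finite_singleton (1 : H)).subset ?_
    exact Set.support_indicator_subset
  | succ n ih =>
    refine (S.finite_toSet.biUnion fun h _ => ih.image (fun x => h * x)).subset ?_
    intro g hg
    rw [Function.mem_support, convPow_succ_apply S π hS] at hg
    obtain ⟨h, hh, hne⟩ := Finset.exists_ne_zero_of_sum_ne_zero hg
    simp only [Set.mem_iUnion, Set.mem_image]
    exact ⟨h, hh, h⁻¹ * g, right_ne_zero_of_mul hne, by group⟩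

lemma summable_convPow_mul {H : Type*} [Group H] (S : Finset H) (π : H → ℝ)
    (hS : ∀ x, x ∉ S → π x = 0) (n : ℕ) (u : H → ℝ) :
    Summable fun p => convPow π n p * u p :=
  summable_of_hasFiniteSupport ((convPow_finite S π hS n).subset
    (Function.support_mul_subset_left _ _))

lemma tsum_convPow {H : Type*} [Group H] (S : Finset H) (π : H → ℝ)
    (hS : ∀ x, x ∉ S → π x = 0) (u : H → ℝ) (n : ℕ) (z : H) :
    ∑' p, convPow π n p * u (z * p) = ((mop S π) ^ n) u z := by
  induction n generalizing z with
  | zero =>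
    rw [tsum_eq_single 1]
    · simp [convPow]
    · intro b hb
      simp [convPow, hb]
  | succ n ih =>
    rw [pow_succ', Module.End.mul_apply, mop_apply]
    have key : ∀ h, ∑' p, convPow π n (h⁻¹ * p) * u (z * p) = ((mop S π) ^ n) u (z * h) := by
      intro h
      rw [← ih, ← (Equiv.mulLeft h).tsum_eq]
      simp [mul_assoc]
    have hs : ∀ h, Summable fun p => convPow π n (h⁻¹ * p) * u (z * p) := by
      intro h
      rw [← (Equiv.mulLeft h).summable_iff]
      simpa [Function.comp_def] using
        summable_convPow_mul S π hS n (fun p => u (z * (h * p)))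
    simp_rw [convPow_succ_apply S π hS, Finset.sum_mul, mul_assoc]
    rw [Summable.tsum_finsetSum fun h _ => (hs h).mul_left (π h)]
    exact Finset.sum_congr rfl fun h _ => by rw [tsum_mul_left, key]

/-- `g ⊗ g`. -/
def tens {G : Type*} (g : G → ℝ) : G × G → ℝ := fun p => g p.1 * g p.2

lemma mop_tens {G : Type*} [Group G] (S : Finset G) (μ : G → ℝ) (ρ : ℝ) (g : G → ℝ) :
    mop (S ×ˢ S) (noise μ ρ) (tens g) =
      (1 - ρ) • ∑ s ∈ S, μ s • tens (fun x => g (x * s)) + ρ • tens (mop S μ g) := by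
  classical
  funext ⟨x, y⟩
  have h1 : ∀ s ∈ S, ∑ t ∈ S, (1 - ρ) * diagM μ (s, t) * (g (x * s) * g (y * t))
      = (1 - ρ) * (μ s * (g (x * s) * g (y * s))) := by
    intro s hs
    rw [Finset.sum_eq_single s]
    · simp [diagM]; ring
    · intro t _ hts
      have : s ≠ t := fun h => hts h.symm
      simp [diagM, this]
    · intro h; exact absurd hs h
  simp only [mop_apply, tens, noise, prodM, Finset.sum_product, Pi.add_apply, Pi.smul_apply,
    Finset.sum_apply, smul_eq_mul, Prod.mk_mul_mk, add_mul, Finset.sum_add_distrib]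
  congr 1
  · rw [Finset.mul_sum]
    exact Finset.sum_congr rfl h1
  · rw [Finset.sum_mul_sum, Finset.mul_sum]
    refine Finset.sum_congr rfl fun s _ => ?_
    rw [Finset.mul_sum]
    exact Finset.sum_congr rfl fun t _ => by ring

lemma mop_pow_tens_nonneg {G : Type*} [Group G] (S : Finset G) (μ : G → ℝ)
    (hμ : ∀ x, 0 ≤ μ x) (ρ : ℝ) (h0 : 0 ≤ ρ) (h1 : ρ ≤ 1) (n : ℕ) (g : G → ℝ) (z : G) :
    0 ≤ ((mop (S ×ˢ S) (noise μ ρ)) ^ n) (tens g) (z, z) := by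
  induction n generalizing g with
  | zero => exact mul_self_nonneg _
  | succ n ih =>
    rw [pow_succ, Module.End.mul_apply, mop_tens]
    simp only [map_add, map_smul, map_sum, Pi.add_apply, Pi.smul_apply, Finset.sum_apply,
      smul_eq_mul]
    refine add_nonneg (mul_nonneg (by linarith) (Finset.sum_nonneg fun s _ => ?_))
      (mul_nonneg h0 (ih _))
    exact mul_nonneg (hμ s) (ih _)

lemma harmonic_step {G : Type*} [Group G]
    (μ : G → ℝ) (hprob : IsProbMeasure μ) (hfin : (Function.support μ).Finite)
    (hNS : L1NoiseSensitive μ) (f : G → ℝ) (hf : Harmonic μ f)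
    (hb : ∃ C, ∀ g, |f g| ≤ C) (s : G) (hs : μ s ≠ 0) : f s = f 1 := by
  classical
  obtain ⟨C, hC⟩ := hb
  have hμ := hprob.1
  set S : Finset G := hfin.toFinset with hSdef
  have hS : ∀ x, x ∉ S → μ x = 0 := by
    intro x hx
    simpa [hSdef] using hx
  have hsum1 : ∑ x ∈ S, μ x = 1 := by
    rw [← hprob.2]
    exact (tsum_eq_sum fun b hb => hS b hb).symm
  have hM : mop S μ f = f := by
    funext y
    rw [mop_apply, hf y]
    exact (tsum_eq_sum fun b hb => by simp [hS b hb]).symm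
  have hMn : ∀ n : ℕ, ((mop S μ) ^ n) f = f := by
    intro n
    induction n with
    | zero => rfl
    | succ n ih => rw [pow_succ, Module.End.mul_apply, hM, ih]
  set ρ : ℝ := 1 / 2 with hρ
  have hN := hNS ρ ⟨by norm_num [hρ], by norm_num [hρ]⟩
  set π := noise μ ρ with hπ
  have hSS : ∀ p, p ∉ S ×ˢ S → π p = 0 := by
    rintro ⟨a, b⟩ hp
    rw [Finset.mem_product, not_and_or] at hp
    rcases hp with h | h
    · have := hS a h
      simp [hπ, noise, diagM, prodM, this, Set.indicator_apply]
    · have := hS b h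
      by_cases hab : a = b
      · subst hab
        simp [hπ, noise, diagM, prodM, this, Set.indicator_apply]
      · simp [hπ, noise, diagM, prodM, this, Set.indicator_apply, hab]
  set P := mop (S ×ˢ S) π with hP
  set d : G → G → ℝ := fun s x => f (x * s) - f x with hd
  have hD : P (tens f) = tens f + (1 - ρ) • ∑ s ∈ S, μ s • tens (d s) := by
    rw [hP, hπ, mop_tens, hM]
    funext ⟨x, y⟩
    simp only [tens, Pi.add_apply, Pi.smul_apply, Finset.sum_apply, smul_eq_mul, hd]
    have hx : ∑ s ∈ S, μ s * f (x * s) = f x := congrFun hM x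
    have hy : ∑ s ∈ S, μ s * f (y * s) = f y := congrFun hM y
    have : ∑ s ∈ S, μ s * ((f (x * s) - f x) * (f (y * s) - f y))
        = ∑ s ∈ S, μ s * (f (x * s) * f (y * s)) - f x * f y := by
      have e : ∀ s ∈ S, μ s * ((f (x * s) - f x) * (f (y * s) - f y))
          = μ s * (f (x * s) * f (y * s)) - (μ s * f (x * s)) * f y - f x * (μ s * f (y * s))
            + μ s * (f x * f y) := fun s _ => by ring
      rw [Finset.sum_congr rfl e, Finset.sum_add_distrib, Finset.sum_sub_distrib,
        Finset.sum_sub_distrib, ← Finset.sum_mul, ← Finset.mul_sum, ← Finset.sum_mul, hx, hy,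
        hsum1]
      ring
    rw [this]
    ring
  set δ : ℝ := (1 - ρ) * ∑ s ∈ S, μ s * (d s 1 * d s 1) with hδ
  have hlow : ∀ n : ℕ, f 1 * f 1 + δ ≤ (P ^ (n + 1)) (tens f) 1 := by
    intro n
    induction n with
    | zero =>
      rw [zero_add, pow_one, hD]
      simp [tens, hδ]
    | succ n ih =>
      refine ih.trans ?_
      rw [pow_succ P (n + 1), Module.End.mul_apply, hD]
      simp only [map_add, map_smul, map_sum, Pi.add_apply, Pi.smul_apply, Finset.sum_apply,
        smul_eq_mul]
      refine le_add_of_nonneg_right (mul_nonneg (by norm_num [hρ])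
        (Finset.sum_nonneg fun s _ => mul_nonneg (hμ s) ?_))
      exact mop_pow_tens_nonneg S μ hμ ρ (by norm_num [hρ]) (by norm_num [hρ]) (n + 1) (d s) 1
  have hup : ∀ n : ℕ, (P ^ n) (tens f) 1 - f 1 * f 1
      ≤ l1dist (convPow π n) (prodM (convPow μ n) (convPow μ n)) * (C * C) := by
    intro n
    have e1 := tsum_convPow (S ×ˢ S) π hSS (tens f) n 1
    have e2 := tsum_convPow S μ hS f n 1
    rw [hMn] at e2
    simp only [one_mul] at e1 e2
    have s1 := summable_convPow_mul (S ×ˢ S) π hSS n (tens f)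
    have s2 := summable_convPow_mul S μ hS n f
    have hpf : (Function.support (prodM (convPow μ n) (convPow μ n))).Finite := by
      refine ((convPow_finite S μ hS n).prod (convPow_finite S μ hS n)).subset ?_
      rintro ⟨a, b⟩ h
      exact ⟨left_ne_zero_of_mul h, right_ne_zero_of_mul h⟩
    have s3 : Summable fun p => prodM (convPow μ n) (convPow μ n) p * tens f p :=
      summable_of_hasFiniteSupport (hpf.subset (Function.support_mul_subset_left _ _))
    have e3 : ∑' p, prodM (convPow μ n) (convPow μ n) p * tens f p = f 1 * f 1 := by
      rw [← e2, tsum_mul_tsum_of_summable_norm s2.norm s2.norm]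
      exact tsum_congr fun p => by simp only [prodM, tens]; ring
    have s4 : Summable fun p => |convPow π n p - prodM (convPow μ n) (convPow μ n) p| := by
      refine Summable.abs (Summable.sub ?_ ?_)
      · exact summable_of_hasFiniteSupport (convPow_finite (S ×ˢ S) π hSS n)
      · exact summable_of_hasFiniteSupport hpf
    rw [← e1, ← e3, ← Summable.tsum_sub s1 s3, l1dist, ← tsum_mul_right]
    refine Summable.tsum_le_tsum (fun p => ?_) (s1.sub s3) (s4.mul_right _)
    rw [← sub_mul]
    refine (le_abs_self _).trans ?_
    rw [abs_mul]
    refine mul_le_mul_of_nonneg_left ?_ (abs_nonneg _)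
    rw [tens, abs_mul]
    exact mul_le_mul (hC _) (hC _) (abs_nonneg _) ((abs_nonneg _).trans (hC 1))
  have hδ0 : δ ≤ 0 := by
    have t := (hN.mul_const (C * C)).comp (tendsto_add_atTop_nat 1)
    rw [zero_mul] at t
    refine ge_of_tendsto' t fun n => ?_
    have a := hlow n
    have b := hup (n + 1)
    simp only [Function.comp_apply]
    linarith
  have hnn : ∀ s ∈ S, 0 ≤ μ s * (d s 1 * d s 1) :=
    fun s _ => mul_nonneg (hμ s) (mul_self_nonneg _)
  have hz : ∑ s ∈ S, μ s * (d s 1 * d s 1) = 0 := by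
    refine le_antisymm ?_ (Finset.sum_nonneg hnn)
    have : δ = (1 / 2) * ∑ s ∈ S, μ s * (d s 1 * d s 1) := by rw [hδ, hρ]; norm_num
    linarith
  have hsS : s ∈ S := by
    by_contra h
    exact hs (hS s h)
  have := (Finset.sum_eq_zero_iff_of_nonneg hnn).1 hz s hsS
  have h2 : d s 1 = 0 := by simpa [hs] using this
  simp only [hd, one_mul] at h2
  linarith

/-- If `(G,μ)` is `ℓ¹`-noise sensitive (with `μ` a finitely
supported generating probability measure on a countable group `G`), then
`(G,μ)` is Liouville. -/
theorem l1NoiseSensitive_liouville {G : Type*} [Group G] [Countable G]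
    (μ : G → ℝ) (hprob : IsProbMeasure μ) (hfin : (Function.support μ).Finite)
    (hgen : Subgroup.closure (Function.support μ) = ⊤)
    (hNS : L1NoiseSensitive μ) :
    Liouville μ := by
  intro f hf hb
  have step : ∀ s ∈ Function.support μ, ∀ g, f (g * s) = f g := by
    intro s hs g
    have := harmonic_step μ hprob hfin hNS (fun x => f (g * x))
      (fun y => by simpa [mul_assoc] using hf (g * y))
      (hb.imp fun C hC x => hC (g * x)) s hs
    simpa using this
  have all : ∀ s : G, ∀ g, f (g * s) = f g := by
    intro s
    have hs : s ∈ Subgroup.closure (Function.support μ) := by rw [hgen]; trivial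
    induction hs using Subgroup.closure_induction with
    | mem x hx => exact step x hx
    | one => simp
    | mul x y _ _ hx hy => intro g; rw [← mul_assoc, hy, hx]
    | inv x _ hx => intro g; rw [← hx (g * x⁻¹)]; simp
  intro x y
  have := all (x⁻¹ * y) x
  simpa using this.symm

end NS
end

section
/- Let G be a finitely generated group and μ a finitely supported probability measure on G whose support generates G. If (G,μ) is partially entropy noise sensitive, then the asymptotic entropy vanishes: H(μ_n)/n → 0 as n → ∞ (equivalently, by the Kaimanovich–Vershik theorem, (G,μ) is Liouville). -/
open Filter

namespace NS

/-- Finitely supported probability measure. -/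
structure FP {E : Type*} (ξ : E → ℝ) : Prop where
  nonneg : ∀ x, 0 ≤ ξ x
  fin : (Function.support ξ).Finite
  sum : ∑' x, ξ x = 1

lemma conv_support {G : Type*} [Group G] (μ ν : G → ℝ) :
    Function.support (conv μ ν) ⊆
      Set.image2 (fun x y => x * y) (Function.support μ) (Function.support ν) := by
  intro z hz
  by_contra hcon
  apply hz
  have : ∀ h, μ h * ν (h⁻¹ * z) = 0 := by
    intro h
    by_contra hne
    exact hcon ⟨h, left_ne_zero_of_mul hne, h⁻¹ * z, right_ne_zero_of_mul hne, by simp⟩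
  simp [conv, this]

lemma conv_fin {G : Type*} [Group G] {μ ν : G → ℝ} (hμ : (Function.support μ).Finite)
    (hν : (Function.support ν).Finite) : (Function.support (conv μ ν)).Finite :=
  (hμ.image2 _ hν).subset (conv_support μ ν)

lemma summable_pair {G : Type*} [Group G] {μ ν : G → ℝ} (hμ : (Function.support μ).Finite)
    (hν : (Function.support ν).Finite) (φ : G → G → ℝ) :
    Summable (Function.uncurry fun h z => μ h * ν (h⁻¹ * z) * φ h z) := by
  apply summable_of_hasFiniteSupport
  refine (hμ.image2 (fun x y => (x, x * y)) hν).subset ?_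
  rintro ⟨h, z⟩ hz
  simp only [Function.mem_support, Function.uncurry_apply_pair] at hz
  have hz' := left_ne_zero_of_mul hz
  exact ⟨h, left_ne_zero_of_mul hz', h⁻¹ * z, right_ne_zero_of_mul hz', by simp⟩

/-- Integration against a convolution. -/
lemma conv_integral {G : Type*} [Group G] {μ ν : G → ℝ} (hμ : (Function.support μ).Finite)
    (hν : (Function.support ν).Finite) (φ : G → ℝ) :
    ∑' z, conv μ ν z * φ z = ∑' h, ∑' y, μ h * ν y * φ (h * y) := by
  have h1 : ∀ z, conv μ ν z * φ z = ∑' h, μ h * ν (h⁻¹ * z) * φ z := by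
    intro z
    rw [conv, tsum_mul_right]
  simp_rw [h1]
  rw [Summable.tsum_comm (summable_pair hμ hν (fun _ z => φ z))]
  congr 1
  ext h
  rw [← (Equiv.mulLeft h).tsum_eq]
  simp

lemma conv_assoc {G : Type*} [Group G] {μ a b : G → ℝ} (hμ : (Function.support μ).Finite)
    (ha : (Function.support a).Finite) :
    conv μ (conv a b) = conv (conv μ a) b := by
  ext x
  have := conv_integral hμ ha (fun z => b (z⁻¹ * x))
  rw [conv, conv, this]
  congr 1
  ext h
  rw [conv, ← tsum_mul_left]
  congr 1
  ext y
  simp [mul_assoc]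

lemma FP.conv {G : Type*} [Group G] {μ ν : G → ℝ} (hμ : FP μ) (hν : FP ν) :
    FP (conv μ ν) where
  nonneg x := tsum_nonneg fun h => mul_nonneg (hμ.nonneg _) (hν.nonneg _)
  fin := conv_fin hμ.fin hν.fin
  sum := by
    have := conv_integral hμ.fin hν.fin (fun _ => 1)
    simp only [mul_one] at this
    rw [this]
    simp_rw [tsum_mul_left, hν.sum, mul_one, hμ.sum]

lemma FP.convPow {G : Type*} [Group G] {μ : G → ℝ} (hμ : FP μ) (n : ℕ) :
    FP (convPow μ n) := by
  induction n with
  | zero =>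
    refine ⟨fun x => Set.indicator_nonneg (by simp) x, ?_, ?_⟩
    · exact (Set.finite_singleton (1 : G)).subset Set.support_indicator_subset
    · rw [NS.convPow, tsum_eq_single 1]
      · simp
      · intro b hb
        simp [hb]
  | succ n ih => exact hμ.conv ih

lemma conv_one_left {G : Type*} [Group G] (ν : G → ℝ) :
    conv (({1} : Set G).indicator (fun _ => (1 : ℝ))) ν = ν := by
  ext x
  rw [conv, tsum_eq_single 1]
  · simp
  · intro b hb
    simp [hb]

lemma convPow_add {G : Type*} [Group G] {μ : G → ℝ} (hμ : FP μ) (m n : ℕ) :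
    convPow μ (m + n) = conv (convPow μ m) (convPow μ n) := by
  induction m with
  | zero => simp [convPow, conv_one_left]
  | succ m ih =>
    rw [Nat.add_right_comm]
    change conv μ (convPow μ (m + n)) = conv (conv μ (convPow μ m)) _
    rw [ih, conv_assoc hμ.fin (hμ.convPow m).fin]

lemma FP.le_one {E : Type*} {ξ : E → ℝ} (h : FP ξ) (x : E) : ξ x ≤ 1 := by
  rw [← h.sum]
  exact (summable_of_hasFiniteSupport h.fin).le_tsum x fun y _ => h.nonneg y

lemma FP.entropy_nonneg {E : Type*} {ξ : E → ℝ} (h : FP ξ) : 0 ≤ entropy ξ := by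
  rw [entropy, ← tsum_neg]
  refine tsum_nonneg fun x => ?_
  have := Real.mul_log_nonpos (h.nonneg x) (h.le_one x)
  linarith

lemma entropy_conv_le {G : Type*} [Group G] {μ ν : G → ℝ} (hμ : FP μ) (hν : FP ν) :
    entropy (conv μ ν) ≤ entropy μ + entropy ν := by
  have key := conv_integral hμ.fin hν.fin (fun z => Real.log (conv μ ν z))
  have fin2 : ∀ (c : ℝ) (φ : G → ℝ), Summable fun y => c * ν y * φ y := by
    intro c φ
    apply summable_of_hasFiniteSupport
    refine hν.fin.subset ?_
    intro y hy
    exact right_ne_zero_of_mul (left_ne_zero_of_mul hy)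
  have fin1 : ∀ (ψ : G → ℝ), Summable fun y => μ y * ψ y := by
    intro φ
    apply summable_of_hasFiniteSupport
    refine hμ.fin.subset ?_
    intro y hy
    exact left_ne_zero_of_mul hy
  have hge : ∀ h y, μ h * ν y * (Real.log (μ h) + Real.log (ν y)) ≤
      μ h * ν y * Real.log (conv μ ν (h * y)) := by
    intro h y
    rcases (hμ.nonneg h).eq_or_lt with h0 | h0
    · simp [← h0]
    rcases (hν.nonneg y).eq_or_lt with h1 | h1
    · simp [← h1]
    refine mul_le_mul_of_nonneg_left ?_ (mul_pos h0 h1).le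
    rw [← Real.log_mul h0.ne' h1.ne']
    apply Real.log_le_log (mul_pos h0 h1)
    have hs := fin1 (fun k => ν (k⁻¹ * (h * y)))
    have := hs.le_tsum h fun k _ => mul_nonneg (hμ.nonneg _) (hν.nonneg _)
    simpa [conv] using this
  have hin : ∀ h, ∑' y, μ h * ν y * (Real.log (μ h) + Real.log (ν y)) =
      μ h * Real.log (μ h) + μ h * ∑' y, ν y * Real.log (ν y) := by
    intro h
    simp_rw [mul_add]
    rw [(fin2 _ _).tsum_add (fin2 _ _)]
    congr 1
    · rw [tsum_mul_right, tsum_mul_left, hν.sum, mul_one]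
    · rw [← tsum_mul_left]
      simp_rw [mul_assoc]
  have hout : ∑' h, ∑' y, μ h * ν y * (Real.log (μ h) + Real.log (ν y)) =
      ∑' h, μ h * Real.log (μ h) + ∑' y, ν y * Real.log (ν y) := by
    simp_rw [hin]
    rw [(fin1 _).tsum_add (fin1 _), tsum_mul_right, hμ.sum, one_mul]
  have hle : ∑' h, ∑' y, μ h * ν y * (Real.log (μ h) + Real.log (ν y)) ≤
      ∑' h, ∑' y, μ h * ν y * Real.log (conv μ ν (h * y)) := by
    refine Summable.tsum_le_tsum (fun h => ?_) ?_ ?_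
    · exact (fin2 _ _).tsum_le_tsum (hge h) (fin2 _ _)
    · simp_rw [mul_assoc, tsum_mul_left]
      exact fin1 _
    · simp_rw [mul_assoc, tsum_mul_left]
      exact fin1 _
  rw [entropy, entropy, entropy, key]
  linarith

lemma subadd {G : Type*} [Group G] {μ : G → ℝ} (hμ : FP μ) :
    Subadditive fun n => entropy (convPow μ n) := by
  intro m n
  simp only
  rw [convPow_add hμ]
  exact entropy_conv_le (hμ.convPow m) (hμ.convPow n)

lemma bdd {G : Type*} [Group G] {μ : G → ℝ} (hμ : FP μ) :
    BddBelow (Set.range fun n : ℕ => entropy (convPow μ n) / n) :=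
  ⟨0, by
    rintro _ ⟨n, rfl⟩
    exact div_nonneg (hμ.convPow n).entropy_nonneg n.cast_nonneg⟩

lemma tsum_diag {G : Type*} (f : G × G → ℝ) (hf : ∀ p, p.1 ≠ p.2 → f p = 0) :
    ∑' p, f p = ∑' x, f (x, x) := by
  have hinj : Function.Injective (fun x : G => (x, x)) := fun a b h => (Prod.ext_iff.1 h).1
  refine (hinj.tsum_eq ?_).symm
  rintro ⟨x, y⟩ hp
  by_cases h : x = y
  · exact ⟨x, by simp [h]⟩
  · exact absurd (hf (x, y) h) hp

lemma diagM_same {G : Type*} [Group G] (μ : G → ℝ) (x : G) : diagM μ (x, x) = μ x := by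
  simp [diagM]

lemma diagM_ne {G : Type*} [Group G] (μ : G → ℝ) (p : G × G) (h : p.1 ≠ p.2) :
    diagM μ p = 0 := by
  simp [diagM, h]

lemma conv_diag {G : Type*} [Group G] (μ ν : G → ℝ) :
    conv (diagM μ) (diagM ν) = diagM (conv μ ν) := by
  ext ⟨x, y⟩
  rw [conv, tsum_diag _ (fun p hp => by rw [diagM_ne μ p hp, zero_mul])]
  by_cases h : x = y
  · subst h
    rw [diagM_same, conv]
    congr 1
    ext k
    rw [diagM_same]
    change _ * diagM ν (k⁻¹ * x, k⁻¹ * x) = _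
    rw [diagM_same]
  · rw [diagM_ne _ _ h]
    convert tsum_zero with k
    rw [diagM_ne ν _ (by simpa using h), mul_zero]

lemma convPow_diag {G : Type*} [Group G] (μ : G → ℝ) (n : ℕ) :
    convPow (diagM μ) n = diagM (convPow μ n) := by
  induction n with
  | zero =>
    ext ⟨x, y⟩
    by_cases h : x = y
    · subst h
      rw [diagM_same]
      by_cases h1 : x = 1
      · simp [convPow, h1]
      · simp [convPow, h1]
    · rw [diagM_ne _ _ h]
      simp only [convPow]
      apply Set.indicator_of_notMem
      rintro ⟨⟩
      exact h rfl
  | succ n ih => rw [convPow, ih, conv_diag, convPow]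

lemma entropy_diag {G : Type*} [Group G] (μ : G → ℝ) : entropy (diagM μ) = entropy μ := by
  rw [entropy, tsum_diag _ (fun p hp => by rw [diagM_ne μ p hp, zero_mul])]
  simp_rw [diagM_same]
  rfl

lemma noise_zero {G : Type*} [Group G] (μ : G → ℝ) : noise μ 0 = diagM μ := by
  ext p
  simp [noise]

lemma noise_support {G : Type*} [Group G] (μ : G → ℝ) (ρ : ℝ) :
    Function.support (noise μ ρ) ⊆ Function.support μ ×ˢ Function.support μ := by
  rintro ⟨x, y⟩ hp
  by_contra hcon
  apply hp
  have hor : μ x = 0 ∨ μ y = 0 := by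
    by_contra hne
    push Not at hne
    exact hcon ⟨hne.1, hne.2⟩
  by_cases hxy : x = y
  · subst hxy
    rcases hor with h | h <;> simp [noise, prodM, diagM_same, h]
  · rw [noise, diagM_ne _ _ hxy]
    rcases hor with h | h <;> simp [prodM, h]

lemma noise_FP {G : Type*} [Group G] {μ : G → ℝ} (hμ : FP μ) {ρ : ℝ} (h0 : 0 ≤ ρ)
    (h1 : ρ ≤ 1) : FP (noise μ ρ) where
  nonneg p := by
    refine add_nonneg (mul_nonneg (by linarith) ?_)
      (mul_nonneg h0 (mul_nonneg (hμ.nonneg _) (hμ.nonneg _)))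
    exact Set.indicator_nonneg (fun _ _ => hμ.nonneg _) _
  fin := (hμ.fin.prod hμ.fin).subset (noise_support μ ρ)
  sum := by
    have hd : Summable (diagM μ) := by
      apply summable_of_hasFiniteSupport
      have := noise_support μ 0
      rw [noise_zero] at this
      exact (hμ.fin.prod hμ.fin).subset this
    have hp : Summable (prodM μ μ) := by
      apply summable_of_hasFiniteSupport
      refine (hμ.fin.prod hμ.fin).subset ?_
      intro p hp
      exact ⟨left_ne_zero_of_mul hp, right_ne_zero_of_mul hp⟩
    have sd : ∑' p, diagM μ p = 1 := by
      rw [tsum_diag _ (diagM_ne μ)]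
      simp_rw [diagM_same]
      exact hμ.sum
    have hs : Summable μ := summable_of_hasFiniteSupport hμ.fin
    have sp : ∑' p, prodM μ μ p = 1 := by
      have := hs.tsum_mul_tsum hs hp
      rw [hμ.sum, mul_one] at this
      exact this.symm
    simp only [noise]
    rw [(hd.mul_left _).tsum_add (hp.mul_left _), tsum_mul_left, tsum_mul_left, sd, sp]
    ring

lemma noise_cont {G : Type*} [Group G] {μ : G → ℝ} (hμ : FP μ) (k : ℕ) :
    ∃ F : Finset (G × G), (∀ ρ, Function.support (convPow (noise μ ρ) k) ⊆ F) ∧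
      ∀ p, Continuous fun ρ => convPow (noise μ ρ) k p := by
  classical
  induction k with
  | zero =>
    refine ⟨{1}, fun ρ => ?_, fun p => continuous_const⟩
    simp only [convPow, Finset.coe_singleton]
    exact Set.support_indicator_subset
  | succ k ih =>
    obtain ⟨F, hF, hc⟩ := ih
    have hS := hμ.fin.prod hμ.fin
    refine ⟨(hS.image2 (fun x y => x * y) F.finite_toSet).toFinset, fun ρ => ?_, fun p => ?_⟩
    · rw [Set.Finite.coe_toFinset]
      exact (conv_support _ _).trans (Set.image2_subset (noise_support μ ρ) (hF ρ))
    · have : (fun ρ => convPow (noise μ ρ) (k + 1) p) = fun ρ =>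
          ∑ h ∈ hS.toFinset, noise μ ρ h * convPow (noise μ ρ) k (h⁻¹ * p) := by
        ext ρ
        rw [convPow, conv]
        apply tsum_eq_sum
        intro b hb
        have : noise μ ρ b = 0 := by
          by_contra hne
          exact hb (hS.mem_toFinset.2 (noise_support μ ρ hne))
        rw [this, zero_mul]
      rw [this]
      refine continuous_finsetSum _ fun h _ => Continuous.mul ?_ (hc _)
      unfold noise
      fun_prop

lemma entropy_cont {G : Type*} [Group G] {μ : G → ℝ} (hμ : FP μ) (k : ℕ) :
    Continuous fun ρ => entropy (convPow (noise μ ρ) k) := by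
  obtain ⟨F, hF, hc⟩ := noise_cont hμ k
  have : (fun ρ => entropy (convPow (noise μ ρ) k)) = fun ρ =>
      -∑ x ∈ F, convPow (noise μ ρ) k x * Real.log (convPow (noise μ ρ) k x) := by
    ext ρ
    rw [entropy]
    congr 1
    apply tsum_eq_sum
    intro b hb
    have : convPow (noise μ ρ) k b = 0 := by
      by_contra hne
      exact hb (hF ρ hne)
    rw [this, zero_mul]
  rw [this]
  exact (continuous_finsetSum _ fun x _ => Real.continuous_mul_log.comp (hc x)).neg

/-- If `(G,μ)` is partially entropy noise sensitive, then the
asymptotic entropy vanishes: `H(μ_n)/n → 0`. -/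
theorem partialEntropyNS_asymptotic_entropy_zero {G : Type*} [Group G] [Countable G]
    (μ : G → ℝ) (hprob : IsProbMeasure μ) (hfin : (Function.support μ).Finite)
    (hgen : Subgroup.closure (Function.support μ) = ⊤)
    (hPNS : ∃ c > (0 : ℝ), ∀ ρ ∈ Set.Ioo (0 : ℝ) 1,
      c ≤ Filter.liminf
        (fun n => (entropy (convPow (noise μ ρ) n) - entropy (convPow μ n))
          / entropy (convPow μ n)) atTop) :
    Tendsto (fun n : ℕ => entropy (convPow μ n) / (n : ℝ)) atTop (nhds 0) := by
  obtain ⟨c, hc, hPNS⟩ := hPNS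
  have hμ : FP μ := ⟨hprob.1, hfin, hprob.2⟩
  have ha := subadd hμ
  have hta := ha.tendsto_lim (bdd hμ)
  set h := ha.lim with hh
  have h0 : 0 ≤ h := ge_of_tendsto' hta fun n =>
    div_nonneg (hμ.convPow n).entropy_nonneg n.cast_nonneg
  rcases h0.eq_or_lt with h0 | hpos
  · rw [← h0] at hta
    exact hta
  exfalso
  have hlt : h < h * (1 + c / 2) := by nlinarith
  obtain ⟨k, hk, hk0⟩ := ((hta.eventually_lt_const hlt).and (eventually_gt_atTop 0)).exists
  have hcont : Continuous fun ρ => entropy (convPow (noise μ ρ) k) / (k : ℝ) :=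
    (entropy_cont hμ k).div_const _
  have hev : ∀ᶠ ρ in nhds (0 : ℝ), entropy (convPow (noise μ ρ) k) / (k : ℝ) < h * (1 + c / 2) := by
    apply hcont.continuousAt.eventually_lt_const
    beta_reduce
    rw [noise_zero, convPow_diag, entropy_diag]
    exact hk
  have hev' := hev.filter_mono (nhdsWithin_le_nhds (s := Set.Ioi 0))
  obtain ⟨ρ, hρ, hρ01⟩ := (hev'.and (Ioo_mem_nhdsGT (zero_lt_one (α := ℝ)))).exists
  have hν := noise_FP hμ hρ01.1.le hρ01.2.le
  have hb := subadd hν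
  have htb := hb.tendsto_lim (bdd hν)
  have hble : hb.lim < h * (1 + c / 2) :=
    (hb.lim_le_div (bdd hν) hk0.ne').trans_lt hρ
  have hlim : Tendsto (fun n => (entropy (convPow (noise μ ρ) n) - entropy (convPow μ n))
      / entropy (convPow μ n)) atTop (nhds ((hb.lim - h) / h)) := by
    refine ((htb.sub hta).div hta hpos.ne').congr' ?_
    filter_upwards [eventually_gt_atTop 0] with n hn
    have hn' : (n : ℝ) ≠ 0 := by exact_mod_cast hn.ne'
    simp only [Pi.div_apply]
    rw [← sub_div, div_div_div_cancel_right₀ hn']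
  have := hPNS ρ hρ01
  rw [hlim.liminf_eq, le_div_iff₀ hpos] at this
  nlinarith [mul_pos hc hpos]


end NS
end

section
/- Let G be a finite group and μ a probability measure on G with μ(1) > 0 whose support generates G. Then (G,μ) is ℓ¹-noise sensitive; moreover the convergence is exponentially fast: for each ρ ∈ (0,1) there exist C > 0 and β ∈ (0,1) such that ‖π_n^ρ − μ_n×μ_n‖₁ ≤ C·βⁿ for all n. -/
open Filter

namespace NS

section helpers
open Finset

variable {K : Type*} [Group K] [Fintype K]

lemma conv_eq (a b : K → ℝ) (g : K) : conv a b g = ∑ h, a h * b (h⁻¹ * g) := by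
  simp [conv, tsum_fintype]

lemma conv_assoc' (a b c : K → ℝ) : conv (conv a b) c = conv a (conv b c) := by
  funext g
  simp only [conv_eq, Finset.sum_mul, Finset.mul_sum]
  rw [Finset.sum_comm]
  refine Finset.sum_congr rfl fun k _ => ?_
  rw [← Equiv.sum_comp (Equiv.mulLeft k)]
  refine Finset.sum_congr rfl fun h _ => ?_
  simp [mul_assoc]

lemma one_conv' (c : K → ℝ) :
    conv (({1} : Set K).indicator (fun _ => (1 : ℝ))) c = c := by
  classical
  funext g
  simp [conv_eq, Pi.single_apply]

lemma convPow_add' (a : K → ℝ) (m n : ℕ) :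
    convPow a (m + n) = conv (convPow a m) (convPow a n) := by
  induction m with
  | zero => simp [convPow, one_conv']
  | succ m ih =>
    rw [show m + 1 + n = (m + n) + 1 by ring]
    simp only [convPow]
    rw [ih, conv_assoc']

lemma conv_nonneg' {a b : K → ℝ} (ha : ∀ x, 0 ≤ a x) (hb : ∀ x, 0 ≤ b x) (g : K) :
    0 ≤ conv a b g := by
  rw [conv_eq]
  exact Finset.sum_nonneg fun h _ => mul_nonneg (ha _) (hb _)

lemma sum_conv' (a b : K → ℝ) : ∑ g, conv a b g = (∑ g, a g) * ∑ g, b g := by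
  simp only [conv_eq]
  rw [Finset.sum_comm, Finset.sum_mul]
  refine Finset.sum_congr rfl fun h _ => ?_
  rw [← Finset.mul_sum]
  congr 1
  exact Equiv.sum_comp (Equiv.mulLeft h⁻¹) b

lemma convPow_nonneg' {a : K → ℝ} (ha : ∀ x, 0 ≤ a x) (n : ℕ) (g : K) :
    0 ≤ convPow a n g := by
  induction n generalizing g with
  | zero => exact Set.indicator_nonneg (fun _ _ => zero_le_one) _
  | succ n ih => exact conv_nonneg' ha ih g

lemma sum_convPow' {a : K → ℝ} (ha : ∑ x, a x = 1) (n : ℕ) :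
    ∑ g, convPow a n g = 1 := by
  classical
  induction n with
  | zero => simp [convPow, Set.indicator_apply]
  | succ n ih => simp only [convPow]; rw [sum_conv', ha, ih, one_mul]

lemma conv_pos' {a b : K → ℝ} (ha : ∀ x, 0 ≤ a x) (hb : ∀ x, 0 ≤ b x) {g h : K}
    (hg : 0 < a g) (hh : 0 < b h) : 0 < conv a b (g * h) := by
  rw [conv_eq]
  refine Finset.sum_pos' (fun k _ => mul_nonneg (ha _) (hb _)) ⟨g, Finset.mem_univ _, ?_⟩
  simpa using mul_pos hg hh

lemma exists_all_pos {a : K → ℝ} (ha : ∀ x, 0 ≤ a x) (h1 : 0 < a 1)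
    (hgen : Subgroup.closure (Function.support a) = ⊤) :
    ∃ N, 1 ≤ N ∧ ∀ g, 0 < convPow a N g := by
  have hmono : ∀ g m n, m ≤ n → 0 < convPow a m g → 0 < convPow a n g := by
    intro g m n hmn h
    induction n, hmn using Nat.le_induction with
    | base => exact h
    | succ n _ ih => simpa [convPow] using conv_pos' ha (convPow_nonneg' ha n) h1 ih
  have key : ∀ g, ∃ n, 0 < convPow a n g := by
    intro g
    have hg : g ∈ Subgroup.closure (Function.support a) := by rw [hgen]; trivial
    have hg' : g ∈ Submonoid.closure (Function.support a) := by
      rw [← Subgroup.mem_toSubmonoid, Subgroup.closure_toSubmonoid_of_finite] at hg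
      exact hg
    induction hg' using Submonoid.closure_induction with
    | mem x hx =>
      refine ⟨1, ?_⟩
      have hx' : 0 < a x := lt_of_le_of_ne (ha x) (Ne.symm hx)
      have := conv_pos' ha (convPow_nonneg' ha 0) (g := x) (h := 1) hx' (by simp [convPow])
      simpa [convPow] using this
    | one => exact ⟨0, by simp [convPow]⟩
    | mul x y _ _ hx hy =>
      obtain ⟨m, hm⟩ := hx (by rw [hgen]; trivial)
      obtain ⟨n, hn⟩ := hy (by rw [hgen]; trivial)
      refine ⟨m + n, ?_⟩
      rw [convPow_add']
      exact conv_pos' (convPow_nonneg' ha m) (convPow_nonneg' ha n) hm hn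
  choose f hf using key
  refine ⟨∑ g, f g + 1, by omega, fun g => hmono g (f g) _ ?_ (hf g)⟩
  have := Finset.single_le_sum (f := f) (fun _ _ => Nat.zero_le _) (Finset.mem_univ g)
  omega

lemma l1_conv_le {a s : K → ℝ} (ε : ℝ) (ha : ∀ x, ε ≤ a x) (hs : ∑ x, s x = 0) :
    ∑ g, |conv a s g| ≤ (∑ x, a x - Fintype.card K * ε) * ∑ g, |s g| := by
  have h0 : ∀ g, conv a s g = conv (fun x => a x - ε) s g := by
    intro g
    simp only [conv_eq, sub_mul, Finset.sum_sub_distrib, ← Finset.mul_sum]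
    have : ∑ h, s (h⁻¹ * g) = 0 := by
      rw [← hs]
      exact Equiv.sum_comp ((Equiv.inv K).trans (Equiv.mulRight g)) s
    rw [this]; ring
  calc ∑ g, |conv a s g| ≤ ∑ g, conv (fun x => a x - ε) (fun x => |s x|) g := by
        refine Finset.sum_le_sum fun g _ => ?_
        rw [h0, conv_eq, conv_eq]
        refine (Finset.abs_sum_le_sum_abs _ _).trans (le_of_eq ?_)
        refine Finset.sum_congr rfl fun h _ => ?_
        rw [abs_mul, abs_of_nonneg (sub_nonneg.2 (ha h))]
    _ = _ := by
        rw [sum_conv', Finset.sum_sub_distrib]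
        simp

lemma decay {a : ℕ → ℝ} {δ : ℝ} {N : ℕ} (hN : 1 ≤ N) (ha : ∀ n, 0 ≤ a n)
    (hδ : 0 < δ) (hδ1 : δ < 1) (h1 : ∀ n, a (n + 1) ≤ a n)
    (h2 : ∀ n, a (N + n) ≤ δ * a n) :
    ∃ C > (0 : ℝ), ∃ β ∈ Set.Ioo (0 : ℝ) 1, ∀ n, a n ≤ C * β ^ n := by
  have hanti : Antitone a := antitone_nat_of_succ_le h1
  set β : ℝ := δ ^ ((N : ℝ)⁻¹) with hβ
  have hN' : (0 : ℝ) < (N : ℝ)⁻¹ := by positivity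
  have hβN : β ^ N = δ := Real.rpow_inv_natCast_pow hδ.le (by omega)
  have hβ0 : 0 < β := Real.rpow_pos_of_pos hδ _
  have hβ1 : β < 1 := Real.rpow_lt_one hδ.le hδ1 hN'
  refine ⟨(a 0 + 1) / δ, div_pos (by linarith [ha 0]) hδ, β, ⟨hβ0, hβ1⟩, fun n => ?_⟩
  induction n using Nat.strong_induction_on with
  | _ n ih =>
    rcases lt_or_ge n N with h | h
    · have e1 : a n ≤ a 0 := hanti (Nat.zero_le n)
      have e2 : δ ≤ β ^ n := by
        rw [← hβN]; exact pow_le_pow_of_le_one hβ0.le hβ1.le h.le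
      calc a n ≤ (a 0 + 1) / δ * δ := by rw [div_mul_cancel₀ _ hδ.ne']; linarith
        _ ≤ _ := by
          refine mul_le_mul_of_nonneg_left e2 (div_nonneg (by linarith [ha 0]) hδ.le)
    · obtain ⟨k, rfl⟩ := Nat.exists_eq_add_of_le h
      calc a (N + k) ≤ δ * a k := h2 k
        _ ≤ δ * ((a 0 + 1) / δ * β ^ k) :=
          mul_le_mul_of_nonneg_left (ih k (by omega)) hδ.le
        _ = _ := by rw [pow_add, hβN]; ring

lemma conv_sub_unif {a b : K → ℝ} (u : ℝ) (ha : ∑ x, a x = 1) (g : K) :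
    conv a (fun x => b x - u) g = conv a b g - u := by
  simp only [conv_eq, mul_sub, Finset.sum_sub_distrib, ← Finset.sum_mul, ha, one_mul]

lemma mixing {a : K → ℝ} (ha : ∀ x, 0 ≤ a x) (hs : ∑ x, a x = 1) (h1 : 0 < a 1)
    (hgen : Subgroup.closure (Function.support a) = ⊤) :
    ∃ C > (0 : ℝ), ∃ β ∈ Set.Ioo (0 : ℝ) 1, ∀ n,
      ∑ g, |convPow a n g - (Fintype.card K : ℝ)⁻¹| ≤ C * β ^ n := by
  obtain ⟨N, hN, hpos⟩ := exists_all_pos ha h1 hgen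
  obtain ⟨g₀, hg₀⟩ := Finite.exists_min (convPow a N)
  set u : ℝ := (Fintype.card K : ℝ)⁻¹ with hu
  have hc : (0 : ℝ) < Fintype.card K := by exact_mod_cast Fintype.card_pos
  have hzero : ∀ n, ∑ g, (convPow a n g - u) = 0 := by
    intro n
    rw [Finset.sum_sub_distrib, sum_convPow' hs]
    simp [hu, hc.ne']
  have hNN : ∀ n, 0 ≤ ∑ g, |convPow a n g - u| := fun n =>
    Finset.sum_nonneg fun _ _ => abs_nonneg _
  set ε := convPow a N g₀ with hε
  refine decay (δ := max (1 - Fintype.card K * ε) (1 / 2)) hN hNN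
    (lt_of_lt_of_le (by norm_num) (le_max_right _ _)) (max_lt ?_ (by norm_num)) ?_ ?_
  · have := mul_pos hc (hpos g₀); linarith
  · intro n
    have := l1_conv_le (a := a) 0 ha (hzero n)
    simp only [conv_sub_unif u hs, hs] at this
    simpa [convPow] using this
  · intro n
    have := l1_conv_le (a := convPow a N) ε hg₀ (hzero n)
    simp only [conv_sub_unif u (sum_convPow' hs N), sum_convPow' hs N] at this
    rw [convPow_add']
    exact this.trans (mul_le_mul_of_nonneg_right (le_max_left _ _) (hNN n))

lemma prodM_convPow (μ : K → ℝ) (n : ℕ) :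
    prodM (convPow μ n) (convPow μ n) = convPow (noise μ 1) n := by
  classical
  induction n with
  | zero =>
    funext p
    rcases p with ⟨x, y⟩
    by_cases hx : x = 1 <;> by_cases hy : y = 1 <;>
      simp [prodM, convPow, Set.indicator_apply, hx, hy, Prod.ext_iff]
  | succ n ih =>
    simp only [convPow]
    rw [← ih]
    funext p
    simp only [prodM, conv_eq, noise, Fintype.sum_prod_type, Finset.sum_mul_sum]
    refine Finset.sum_congr rfl fun x _ => Finset.sum_congr rfl fun y _ => ?_
    simp only [Prod.fst_mul, Prod.snd_mul, Prod.fst_inv, Prod.snd_inv]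
    ring

lemma noise_mixing {μ : K → ℝ} (ha : ∀ x, 0 ≤ μ x) (hs : ∑ x, μ x = 1) (h1 : 0 < μ 1)
    (hgen : Subgroup.closure (Function.support μ) = ⊤) {ρ : ℝ} (hρ : 0 < ρ) (hρ1 : ρ ≤ 1) :
    ∃ C > (0 : ℝ), ∃ β ∈ Set.Ioo (0 : ℝ) 1, ∀ n,
      ∑ g, |convPow (noise μ ρ) n g - (Fintype.card (K × K) : ℝ)⁻¹| ≤ C * β ^ n := by
  classical
  have hd : ∀ p, 0 ≤ diagM μ p := fun p => Set.indicator_nonneg (fun _ _ => ha _) _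
  have hge : ∀ p : K × K, ρ * (μ p.1 * μ p.2) ≤ noise μ ρ p := by
    intro p
    have := mul_nonneg (sub_nonneg.2 hρ1) (hd p)
    simp only [noise, prodM]; linarith
  have hn : ∀ p, 0 ≤ noise μ ρ p := fun p =>
    (mul_nonneg hρ.le (mul_nonneg (ha _) (ha _))).trans (hge p)
  refine mixing hn ?_ ?_ ?_
  · simp only [noise, Finset.sum_add_distrib, ← Finset.mul_sum]
    have e1 : ∑ p, diagM μ p = 1 := by
      simp [Fintype.sum_prod_type, diagM, Set.indicator_apply, hs]
    have e2 : ∑ p, prodM μ μ p = 1 := by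
      simp [Fintype.sum_prod_type, prodM, ← Finset.mul_sum, hs]
    rw [e1, e2]; ring
  · exact (mul_pos hρ (mul_pos h1 h1)).trans_le (hge 1)
  · set H := Subgroup.closure (Function.support (noise μ ρ)) with hH
    have hmem : ∀ x y, μ x ≠ 0 → μ y ≠ 0 → (x, y) ∈ H := by
      intro x y hx hy
      apply Subgroup.subset_closure
      have hx' : 0 < μ x := lt_of_le_of_ne (ha x) (Ne.symm hx)
      have hy' : 0 < μ y := lt_of_le_of_ne (ha y) (Ne.symm hy)
      exact ((mul_pos hρ (mul_pos hx' hy')).trans_le (hge (x, y))).ne'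
    have hl : ∀ x : K, (x, (1 : K)) ∈ H := by
      have : Subgroup.closure (Function.support μ) ≤ H.comap (MonoidHom.inl K K) :=
        (Subgroup.closure_le _).2 fun x hx => hmem x 1 hx h1.ne'
      intro x
      exact this (by rw [hgen]; trivial)
    have hr : ∀ x : K, ((1 : K), x) ∈ H := by
      have : Subgroup.closure (Function.support μ) ≤ H.comap (MonoidHom.inr K K) :=
        (Subgroup.closure_le _).2 fun x hx => hmem 1 x h1.ne' hx
      intro x
      exact this (by rw [hgen]; trivial)
    refine (Subgroup.eq_top_iff' H).2 fun p => ?_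
    have := H.mul_mem (hl p.1) (hr p.2)
    simpa using this

end helpers

/-- Any finite group with a lazy generating measure is
`ℓ¹`-noise sensitive, with exponentially fast convergence. -/
theorem finite_group_l1NS {G : Type*} [Group G] [Finite G]
    (μ : G → ℝ) (hprob : IsProbMeasure μ) (hlazy : 0 < μ 1)
    (hgen : Subgroup.closure (Function.support μ) = ⊤) :
    L1NoiseSensitive μ ∧
      ∀ ρ ∈ Set.Ioo (0 : ℝ) 1, ∃ C > (0 : ℝ), ∃ β ∈ Set.Ioo (0 : ℝ) 1,
        ∀ n : ℕ,
          l1dist (convPow (noise μ ρ) n) (prodM (convPow μ n) (convPow μ n))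
            ≤ C * β ^ n := by
  have := Fintype.ofFinite G
  obtain ⟨ha, hs⟩ := hprob
  rw [tsum_fintype] at hs
  have main : ∀ ρ ∈ Set.Ioo (0 : ℝ) 1, ∃ C > (0 : ℝ), ∃ β ∈ Set.Ioo (0 : ℝ) 1,
        ∀ n : ℕ,
          l1dist (convPow (noise μ ρ) n) (prodM (convPow μ n) (convPow μ n))
            ≤ C * β ^ n := by
    intro ρ hρ
    obtain ⟨C, hC, β, hβ, h⟩ := noise_mixing ha hs hlazy hgen hρ.1 hρ.2.le
    obtain ⟨C', hC', β', hβ', h'⟩ := noise_mixing ha hs hlazy hgen one_pos le_rfl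
    refine ⟨C + C', by positivity, max β β', ⟨lt_max_of_lt_left hβ.1, max_lt hβ.2 hβ'.2⟩, ?_⟩
    intro n
    rw [prodM_convPow, l1dist, tsum_fintype]
    have e1 : β ^ n ≤ (max β β') ^ n := pow_le_pow_left₀ hβ.1.le (le_max_left _ _) n
    have e2 : β' ^ n ≤ (max β β') ^ n := pow_le_pow_left₀ hβ'.1.le (le_max_right _ _) n
    set u : ℝ := (Fintype.card (G × G) : ℝ)⁻¹
    calc ∑ x, |convPow (noise μ ρ) n x - convPow (noise μ 1) n x|
        ≤ ∑ x, (|convPow (noise μ ρ) n x - u| + |convPow (noise μ 1) n x - u|) := by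
          refine Finset.sum_le_sum fun x _ => ?_
          rw [abs_sub_comm (convPow (noise μ 1) n x) u]
          exact abs_sub_le _ _ _
      _ ≤ C * β ^ n + C' * β' ^ n := by
          rw [Finset.sum_add_distrib]; exact add_le_add (h n) (h' n)
      _ ≤ C * (max β β') ^ n + C' * (max β β') ^ n := by gcongr
      _ = _ := by ring
  refine ⟨fun ρ hρ => ?_, main⟩
  obtain ⟨C, hC, β, hβ, h⟩ := main ρ hρ
  refine squeeze_zero (fun n => tsum_nonneg fun _ => abs_nonneg _) h ?_
  simpa using (tendsto_pow_atTop_nhds_zero_of_lt_one hβ.1.le hβ.2).const_mul C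

end NS
end

section
/- The simple random walk on the infinite dihedral group D∞ = ⟨a,b | a² = b² = 1⟩, with step measure μ(a) = μ(b) = 1/2, is not ℓ¹-noise sensitive: there exists ρ ∈ (0,1) such that ‖π_n^ρ − μ_n×μ_n‖₁ does not converge to 0 as n → ∞. -/
open Filter

namespace NS

/-- The relators `a²`, `b²` of the infinite dihedral group. -/
def dihedralRels : Set (FreeGroup (Fin 2)) :=
  {FreeGroup.of 0 ^ 2, FreeGroup.of 1 ^ 2}

/-- The infinite dihedral group `D∞ = ⟨a, b | a² = b² = 1⟩`. -/
abbrev DInf := PresentedGroup dihedralRels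

/-- The generator `a` of `D∞`. -/
def Da : DInf := PresentedGroup.of 0

/-- The generator `b` of `D∞`. -/
def Db : DInf := PresentedGroup.of 1

/-- The simple random walk measure `μ(a) = μ(b) = 1/2` on `D∞`. -/
noncomputable def muSimple : DInf → ℝ :=
  fun g => ({Da} : Set DInf).indicator (fun _ => (1:ℝ)/2) g +
    ({Db} : Set DInf).indicator (fun _ => (1:ℝ)/2) g

/-- The lazy simple random walk measure `μ(1) = μ(a) = μ(b) = 1/3` on `D∞`. -/
noncomputable def muLazy : DInf → ℝ :=
  fun g => ({1} : Set DInf).indicator (fun _ => (1:ℝ)/3) g +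
    ({Da} : Set DInf).indicator (fun _ => (1:ℝ)/3) g +
    ({Db} : Set DInf).indicator (fun _ => (1:ℝ)/3) g

section Aux

lemma conv_atomic {G ι : Type*} [Group G] [Fintype ι] (μ ν : G → ℝ) (w : ι → ℝ) (x : ι → G)
    (hμ : ∀ g, μ g = ∑ i, ({x i} : Set G).indicator (fun _ => w i) g) (g : G) :
    conv μ ν g = ∑ i, w i * ν ((x i)⁻¹ * g) := by
  classical
  unfold conv
  have h : HasSum (fun h => ∑ i, ({x i} : Set G).indicator (fun _ => w i) h * ν (h⁻¹ * g))
      (∑ i, w i * ν ((x i)⁻¹ * g)) := by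
    apply hasSum_sum
    intro i _
    convert hasSum_single (x i) (f := fun h =>
      ({x i} : Set G).indicator (fun _ => w i) h * ν (h⁻¹ * g)) ?_ using 1
    · simp
    · intro b hb
      simp [hb]
  rw [← h.tsum_eq]
  congr 1
  ext h
  rw [hμ, Finset.sum_mul]

lemma convPow_finite_s12 {G ι : Type*} [Group G] [Fintype ι] (μ : G → ℝ) (w : ι → ℝ) (x : ι → G)
    (hμ : ∀ g, μ g = ∑ i, ({x i} : Set G).indicator (fun _ => w i) g) (n : ℕ) :
    (Function.support (convPow μ n)).Finite := by
  induction n with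
  | zero =>
    apply (Set.finite_singleton (1 : G)).subset
    simp only [convPow]
    exact Set.support_indicator_subset
  | succ n ih =>
    have : Function.support (convPow μ (n+1)) ⊆
        ⋃ i, (fun g => x i * g) '' Function.support (convPow μ n) := by
      intro g hg
      rw [Function.mem_support, convPow, conv_atomic μ _ w x hμ] at hg
      obtain ⟨i, -, hi⟩ := Finset.exists_ne_zero_of_sum_ne_zero hg
      refine Set.mem_iUnion.2 ⟨i, (x i)⁻¹ * g, ?_, by simp⟩
      exact right_ne_zero_of_mul hi
    exact (Set.finite_iUnion fun i => ih.image _).subset this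

lemma summable_mul_fin {E : Type*} (f u : E → ℝ) (hf : (Function.support f).Finite) :
    Summable (fun g => f g * u g) := by
  apply summable_of_hasFiniteSupport
  exact hf.subset (Function.support_mul_subset_left f u)

lemma convPow_eigen {G ι : Type*} [Group G] [Fintype ι] (μ : G → ℝ) (w : ι → ℝ) (x : ι → G)
    (hμ : ∀ g, μ g = ∑ i, ({x i} : Set G).indicator (fun _ => w i) g)
    (u : G → ℝ) (c : ℝ) (hu : ∀ g, ∑ i, w i * u (x i * g) = c * u g) (n : ℕ) :
    HasSum (fun g => convPow μ n g * u g) (c ^ n * u 1) := by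
  induction n with
  | zero =>
    convert hasSum_single (1 : G) (f := fun g => convPow μ 0 g * u g) ?_ using 1
    · simp [convPow]
    · intro b hb
      simp [convPow, hb]
  | succ n ih =>
    have key : ∀ i, HasSum (fun g => w i * convPow μ n ((x i)⁻¹ * g) * u g)
        (∑' g, w i * (convPow μ n g * u (x i * g))) := by
      intro i
      have h := ((summable_mul_fin _ (fun g => u (x i * g))
        (convPow_finite_s12 μ w x hμ n)).mul_left (w i)).hasSum
      rw [← (Equiv.mulLeft (x i)⁻¹).hasSum_iff] at h
      have e : (fun g => w i * convPow μ n ((x i)⁻¹ * g) * u g) =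
          (fun g => w i * (convPow μ n g * u (x i * g))) ∘ ⇑(Equiv.mulLeft (x i)⁻¹) := by
        funext g
        simp [mul_assoc]
      rw [e]
      exact h
    have h2 := hasSum_sum (s := Finset.univ) (fun i _ => key i)
    convert h2 using 1
    · ext g
      rw [convPow, conv_atomic μ _ w x hμ, Finset.sum_mul]
    · rw [← Summable.tsum_finsetSum]
      · have h3 := (ih.mul_left c).tsum_eq
        rw [pow_succ', mul_assoc, ← h3]
        congr 1
        ext g
        rw [mul_left_comm, ← hu, Finset.mul_sum]
        exact Finset.sum_congr rfl fun i _ => by ring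
      · intro i _
        exact ((summable_mul_fin _ (fun g => u (x i * g))
          (convPow_finite_s12 μ w x hμ n)).mul_left (w i))

/-- The two reflections of `ℤ`. -/
def refl2 : Fin 2 → Equiv.Perm ℤ := ![Equiv.subLeft 1, Equiv.subLeft (-1)]

lemma refl2_rels : ∀ r ∈ dihedralRels, FreeGroup.lift refl2 r = 1 := by
  intro r hr
  rcases hr with rfl | rfl <;>
  · ext t
    simp [refl2, pow_two]

/-- The action of `D∞` on `ℤ`. -/
def act : DInf →* Equiv.Perm ℤ := PresentedGroup.toGroup refl2_rels

/-- The orbit map at `0`. -/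
def T (g : DInf) : ℝ := ((act g 0 : ℤ) : ℝ)

lemma T_one : T 1 = 0 := by simp [T]

lemma T_a (g : DInf) : T (Da * g) = 1 - T g := by
  have : act Da = Equiv.subLeft 1 := by
    simp [act, Da, PresentedGroup.toGroup.of, refl2]
  simp [T, this]

lemma T_b (g : DInf) : T (Db * g) = -1 - T g := by
  have : act Db = Equiv.subLeft (-1) := by
    simp [act, Db, PresentedGroup.toGroup.of, refl2]
  simp [T, this]

lemma a_ne_b : Da ≠ Db := by
  intro h
  have h1 := T_a 1
  rw [h, T_b] at h1
  norm_num at h1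

lemma mu_atomic (g : DInf) : muSimple g =
    ∑ i, ({(![Da, Db] : Fin 2 → DInf) i} : Set DInf).indicator
      (fun _ => (![1/2, 1/2] : Fin 2 → ℝ) i) g := by
  simp [muSimple, Fin.sum_univ_two]

lemma noise_atomic (p : DInf × DInf) : noise muSimple (1/2) p =
    ∑ i, ({(![(Da, Da), (Da, Db), (Db, Da), (Db, Db)] : Fin 4 → DInf × DInf) i} :
      Set (DInf × DInf)).indicator
      (fun _ => (![3/8, 1/8, 1/8, 3/8] : Fin 4 → ℝ) i) p := by
  classical
  obtain ⟨g, h⟩ := p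
  have hab := a_ne_b
  have hba := a_ne_b.symm
  simp only [noise, diagM, prodM, muSimple, Fin.sum_univ_four, Set.indicator_apply,
    Set.mem_singleton_iff, Set.mem_ofPred_eq, Prod.mk.injEq, Matrix.cons_val]
  by_cases h1 : g = Da
  · subst h1
    by_cases h2 : h = Da
    · subst h2; simp [hab]; norm_num
    · by_cases h3 : h = Db
      · subst h3; simp [hab, hba]; norm_num
      · simp [hab, h2, h3, Ne.symm h2]
  · by_cases h4 : g = Db
    · subst h4
      by_cases h2 : h = Da
      · subst h2; simp [hab, hba]; norm_num
      · by_cases h3 : h = Db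
        · subst h3; simp [hba]; norm_num
        · simp [hba, h2, h3, Ne.symm h3]
    · simp [h1, h4]

lemma mu_cos (θ : ℝ) (n : ℕ) :
    HasSum (fun g => convPow muSimple n g * Real.cos (θ * T g)) (Real.cos θ ^ n) := by
  have := convPow_eigen muSimple _ _ mu_atomic (fun g => Real.cos (θ * T g)) (Real.cos θ) ?_ n
  · simpa [T_one] using this
  · intro g
    simp only [Fin.sum_univ_two, Matrix.cons_val_zero, Matrix.cons_val_one, T_a, T_b]
    rw [show θ * (1 - T g) = θ - θ * T g by ring,
      show θ * (-1 - T g) = -(θ + θ * T g) by ring, Real.cos_neg, Real.cos_sub, Real.cos_add]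
    ring

lemma mu_sin (θ : ℝ) (n : ℕ) :
    HasSum (fun g => convPow muSimple n g * Real.sin (θ * T g)) 0 := by
  have := convPow_eigen muSimple _ _ mu_atomic (fun g => Real.sin (θ * T g)) (-Real.cos θ) ?_ n
  · simpa [T_one] using this
  · intro g
    simp only [Fin.sum_univ_two, Matrix.cons_val_zero, Matrix.cons_val_one, T_a, T_b]
    rw [show θ * (1 - T g) = θ - θ * T g by ring,
      show θ * (-1 - T g) = -(θ + θ * T g) by ring, Real.sin_neg, Real.sin_sub, Real.sin_add]
    ring

lemma noise_cos (θ : ℝ) (n : ℕ) :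
    HasSum (fun p => convPow (noise muSimple (1/2)) n p * Real.cos (θ * (T p.1 - T p.2)))
      ((1 - Real.sin θ ^ 2 / 2) ^ n) := by
  have := convPow_eigen (noise muSimple (1/2)) _ _ noise_atomic
    (fun p => Real.cos (θ * (T p.1 - T p.2))) (1 - Real.sin θ ^ 2 / 2) ?_ n
  · simpa [T_one] using this
  · intro p
    obtain ⟨g, h⟩ := p
    simp only [Fin.sum_univ_four, Matrix.cons_val, Prod.mk_mul_mk, T_a, T_b]
    rw [show θ * (1 - T g - (1 - T h)) = -(θ * (T g - T h)) by ring,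
      show θ * (-1 - T g - (-1 - T h)) = -(θ * (T g - T h)) by ring,
      show θ * (1 - T g - (-1 - T h)) = 2 * θ - θ * (T g - T h) by ring,
      show θ * (-1 - T g - (1 - T h)) = -(2 * θ + θ * (T g - T h)) by ring,
      Real.cos_neg, Real.cos_neg, Real.cos_sub, Real.cos_add, Real.cos_two_mul, Real.cos_sq']
    ring

lemma prod_finite (n : ℕ) :
    (Function.support (prodM (convPow muSimple n) (convPow muSimple n))).Finite := by
  have h := convPow_finite_s12 muSimple _ _ mu_atomic n
  apply (h.prod h).subset
  intro p hp
  exact ⟨left_ne_zero_of_mul hp, right_ne_zero_of_mul hp⟩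

lemma prod_cos (θ : ℝ) (n : ℕ) :
    HasSum (fun p => prodM (convPow muSimple n) (convPow muSimple n) p *
      Real.cos (θ * (T p.1 - T p.2))) ((1 - Real.sin θ ^ 2) ^ n) := by
  have hs : ∀ v : DInf → ℝ, Summable (fun p : DInf × DInf =>
      (convPow muSimple n p.1 * v p.1) * (convPow muSimple n p.2 * v p.2)) := by
    intro v
    refine (summable_mul_fin _ (fun p => v p.1 * v p.2) (prod_finite n)).congr ?_
    intro p
    simp only [prodM]
    ring
  have h1 := (mu_cos θ n).mul (mu_cos θ n) (hs (fun g => Real.cos (θ * T g)))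
  have h2 := (mu_sin θ n).mul (mu_sin θ n) (hs (fun g => Real.sin (θ * T g)))
  have h3 := h1.add h2
  have e1 : (1 - Real.sin θ ^ 2) ^ n = Real.cos θ ^ n * Real.cos θ ^ n + 0 * 0 := by
    rw [← Real.cos_sq', mul_zero, add_zero, ← mul_pow, sq]
  rw [e1]
  refine Eq.mp (congrArg (fun f => HasSum f _) (funext fun p => ?_)) h3
  symm
  rw [mul_sub, Real.cos_sub]
  unfold prodM
  ring

lemma l1_lower (θ : ℝ) (n : ℕ) :
    (1 - Real.sin θ ^ 2 / 2) ^ n - (1 - Real.sin θ ^ 2) ^ n ≤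
      l1dist (convPow (noise muSimple (1/2)) n)
          (prodM (convPow muSimple n) (convPow muSimple n)) := by
  have h := (noise_cos θ n).sub (prod_cos θ n)
  have hfin : (Function.support (fun p => |convPow (noise muSimple (1/2)) n p -
      prodM (convPow muSimple n) (convPow muSimple n) p|)).Finite := by
    apply ((convPow_finite_s12 _ _ _ noise_atomic n).union (prod_finite n)).subset
    intro p hp
    by_contra hc
    simp only [Set.mem_union, Function.mem_support, not_or, not_not] at hc
    exact hp (by beta_reduce; rw [hc.1, hc.2, sub_zero, abs_zero])
  have hs := (summable_of_hasFiniteSupport (L := SummationFilter.unconditional _) hfin).hasSum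
  refine hasSum_le ?_ h hs
  intro p
  rw [← sub_mul]
  refine (le_abs_self _).trans ?_
  rw [abs_mul]
  exact mul_le_of_le_one_right (abs_nonneg _) (Real.abs_cos_le_one _)

lemma l1_lower' (n : ℕ) (hn : 1 ≤ n) :
    1 / 10 ≤ l1dist (convPow (noise muSimple (1/2)) n)
          (prodM (convPow muSimple n) (convPow muSimple n)) := by
  have hn' : (1 : ℝ) ≤ n := by exact_mod_cast hn
  have hi : (1 : ℝ) / n ≤ 1 := by
    rw [div_le_one (by linarith)]; exact hn'
  have hp : (0 : ℝ) < 1 / n := by positivity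
  have hsin : Real.sin (Real.arcsin (√(1 / n))) ^ 2 = 1 / n := by
    rw [Real.sin_arcsin, Real.sq_sqrt hp.le]
    · linarith [Real.sqrt_nonneg ((1 : ℝ) / n)]
    · exact Real.sqrt_le_one.2 hi
  have h := l1_lower (Real.arcsin (√(1 / n))) n
  rw [hsin] at h
  have hA : 1 / 2 ≤ (1 - (1 : ℝ) / n / 2) ^ n := by
    have := one_add_mul_le_pow (a := -((1 : ℝ) / n / 2)) (by linarith) n
    have e : (n : ℝ) * (1 / n / 2) = 1 / 2 := by field_simp
    rw [← sub_eq_add_neg] at this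
    linarith
  have hB : (1 - (1 : ℝ) / n) ^ n ≤ Real.exp (-1) :=
    Real.one_sub_div_pow_le_exp_neg hn'
  have hC : Real.exp (-1) < 0.4 := by
    linarith [Real.exp_neg_one_lt_d9]
  norm_num at hC
  linarith

end Aux

/-- The simple random walk on the infinite dihedral group is
not `ℓ¹`-noise sensitive. -/
theorem dihedral_simple_not_l1NS :
    ∃ ρ ∈ Set.Ioo (0 : ℝ) 1,
      ¬ Tendsto
        (fun n => l1dist (convPow (noise muSimple ρ) n)
          (prodM (convPow muSimple n) (convPow muSimple n)))
        atTop (nhds 0) := by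
  refine ⟨1/2, by norm_num, ?_⟩
  intro h
  have h1 := h.eventually (gt_mem_nhds (show (0 : ℝ) < 1 / 10 by norm_num))
  obtain ⟨n, hn, hn1⟩ := (h1.and (eventually_ge_atTop 1)).exists
  exact absurd (l1_lower' n hn1) (not_le.2 hn)

end NS
end

section
/- The lazy simple random walk on the infinite dihedral group D∞ = ⟨a,b | a² = b² = 1⟩, with step measure μ(1) = μ(a) = μ(b) = 1/3, is ℓ¹-noise sensitive: for every ρ ∈ (0,1), ‖π_n^ρ − μ_n×μ_n‖₁ → 0 as n → ∞. -/
open Filter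

namespace NS

section abstractPart
set_option linter.unusedSectionVars false
set_option linter.unusedVariables false

/-- First negative moment of the binomial law. -/
lemma binom_neg_one (k : ℕ) (e : ℝ) (h0 : 0 < e) (h1 : e ≤ 1) :
    ∑ j ∈ Finset.range (k+1), e^j * (1-e)^(k-j) * (k.choose j : ℝ) * (1/((j:ℝ)+1))
      ≤ 1/(e*(k+1)) := by
  have h := add_pow e (1-e) (k+1)
  rw [add_sub_cancel, one_pow, Finset.sum_range_succ'] at h
  have hz : 0 ≤ e ^ 0 * (1 - e) ^ (k + 1 - 0) * ((k+1).choose 0 : ℝ) := by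
    have : 0 ≤ 1 - e := by linarith
    positivity
  rw [le_div_iff₀ (by positivity), Finset.sum_mul]
  refine le_trans (le_of_eq ?_) (show ∑ j ∈ Finset.range (k+1), e ^ (j + 1) * (1 - e) ^ (k + 1 - (j + 1)) * ((k + 1).choose (j + 1) : ℝ) ≤ 1 by linarith)
  refine Finset.sum_congr rfl fun j _ => ?_
  have hc : ((k:ℝ)+1) * (k.choose j) = ((k+1).choose (j+1) : ℝ) * (j+1) := by
    exact_mod_cast Nat.add_one_mul_choose_eq k j
  rw [Nat.add_sub_add_right]
  field_simp
  linear_combination (e ^ (j+1) * (1-e)^(k-j)) * hc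

/-- Second negative moment of the binomial law. -/
lemma binom_neg_two (k : ℕ) (e : ℝ) (h0 : 0 < e) (h1 : e ≤ 1) :
    ∑ j ∈ Finset.range (k+1), e^j * (1-e)^(k-j) * (k.choose j : ℝ) * (1/(((j:ℝ)+1)*(j+2)))
      ≤ 1/(e^2*((k+1)*(k+2))) := by
  have h := add_pow e (1-e) (k+2)
  rw [add_sub_cancel, one_pow, Finset.sum_range_succ', Finset.sum_range_succ'] at h
  have he : 0 ≤ 1 - e := by linarith
  have hz : 0 ≤ e ^ 0 * (1 - e) ^ (k + 2 - 0) * ((k+2).choose 0 : ℝ) := by positivity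
  have hz' : 0 ≤ e ^ (0+1) * (1 - e) ^ (k + 2 - (0+1)) * ((k+2).choose (0+1) : ℝ) := by positivity
  rw [le_div_iff₀ (by positivity), Finset.sum_mul]
  refine le_trans (le_of_eq ?_) (show ∑ j ∈ Finset.range (k+1), e ^ (j + 1 + 1) * (1 - e) ^ (k + 2 - (j + 1+1)) * ((k + 2).choose (j + 1+1) : ℝ) ≤ 1 by linarith)
  refine Finset.sum_congr rfl fun j _ => ?_
  have hc : ((k:ℝ)+1) * (k.choose j) = ((k+1).choose (j+1) : ℝ) * (j+1) := by
    exact_mod_cast Nat.add_one_mul_choose_eq k j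
  have hc2 : ((k:ℝ)+2) * ((k+1).choose (j+1)) = ((k+2).choose (j+2) : ℝ) * (j+2) := by
    exact_mod_cast Nat.add_one_mul_choose_eq (k+1) (j+1)
  rw [show k + 2 - (j+1+1) = k - j by omega]
  field_simp
  linear_combination (e ^ (j+2) * (1-e)^(k-j)) * ((k+2) * hc + (j+1) * hc2)

variable {R : Type*} [NormedRing R] [NormedAlgebra ℝ R] [NormOneClass R]

lemma npow_le {x : R} (h : ‖x‖ ≤ 1) (n : ℕ) : ‖x^n‖ ≤ 1 :=
  (norm_pow_le x n).trans (pow_le_one₀ (norm_nonneg _) h)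

lemma nmul_le {x y : R} (hx : ‖x‖ ≤ 1) (hy : ‖y‖ ≤ 1) : ‖x*y‖ ≤ 1 :=
  (norm_mul_le x y).trans (mul_le_one₀ hx (norm_nonneg _) hy)

/-- expansion of `T ^ k * x`. -/
lemma mix_left {S τ x : R} {e : ℝ} (h0 : 0 < e) (h1 : e ≤ 1) (hc : Commute S τ)
    (hτ : ‖τ‖ ≤ 1 - e) (g : ℕ → ℝ) (hg : ∀ j, ‖S^j * x‖ ≤ g j) (k : ℕ) :
    ‖(e • S + τ)^k * x‖ ≤
      ∑ j ∈ Finset.range (k+1), e^j * (1-e)^(k-j) * (k.choose j : ℝ) * g j := by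
  rw [(hc.smul_left e).add_pow, Finset.sum_mul]
  refine norm_sum_le_of_le _ fun j _ => ?_
  have : (e • S)^j * τ^(k-j) * (k.choose j : R) * x
      = (e^j * (k.choose j : ℝ)) • (τ^(k-j) * (S^j * x)) := by
    rw [smul_pow, ((hc.pow_pow j (k-j)).smul_left (e^j)).eq, mul_assoc, mul_assoc,
      ← mul_assoc _ _ x, ← Nat.cast_comm, ← nsmul_eq_mul, ← Nat.cast_smul_eq_nsmul ℝ]
    simp only [smul_mul_assoc, mul_smul_comm, smul_smul]
    rw [mul_comm]
  rw [this, norm_smul, Real.norm_of_nonneg (by positivity)]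
  have h2 : ‖τ^(k-j) * (S^j * x)‖ ≤ (1-e)^(k-j) * g j := by
    refine (norm_mul_le _ _).trans (mul_le_mul ?_ (hg j) (norm_nonneg _) (by
      have : 0 ≤ 1 - e := by linarith
      positivity))
    exact (norm_pow_le _ _).trans (pow_le_pow_left₀ (norm_nonneg _) hτ _)
  calc _ ≤ (e^j * (k.choose j : ℝ)) * ((1-e)^(k-j) * g j) := by gcongr
    _ = _ := by ring

lemma mix_right {S τ x : R} {e : ℝ} (h0 : 0 < e) (h1 : e ≤ 1) (hc : Commute S τ)
    (hτ : ‖τ‖ ≤ 1 - e) (g : ℕ → ℝ) (hg : ∀ j, ‖x * S^j‖ ≤ g j) (k : ℕ) :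
    ‖x * (e • S + τ)^k‖ ≤
      ∑ j ∈ Finset.range (k+1), e^j * (1-e)^(k-j) * (k.choose j : ℝ) * g j := by
  rw [(hc.smul_left e).add_pow, Finset.mul_sum]
  refine norm_sum_le_of_le _ fun j _ => ?_
  have : x * ((e • S)^j * τ^(k-j) * (k.choose j : R))
      = (e^j * (k.choose j : ℝ)) • ((x * S^j) * τ^(k-j)) := by
    rw [smul_pow, ← Nat.cast_comm, ← nsmul_eq_mul, ← Nat.cast_smul_eq_nsmul ℝ]
    simp only [smul_mul_assoc, mul_smul_comm, smul_smul]
    rw [mul_comm, mul_assoc]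
  rw [this, norm_smul, Real.norm_of_nonneg (by positivity)]
  have h2 : ‖(x * S^j) * τ^(k-j)‖ ≤ g j * (1-e)^(k-j) := by
    refine (norm_mul_le _ _).trans (mul_le_mul (hg j) ?_ (norm_nonneg _)
      ((norm_nonneg _).trans (hg j)))
    exact (norm_pow_le _ _).trans (pow_le_pow_left₀ (norm_nonneg _) hτ _)
  calc _ ≤ (e^j * (k.choose j : ℝ)) * (g j * (1-e)^(k-j)) := by gcongr
    _ = _ := by ring

lemma sum1 {C e : ℝ} (hC : 0 ≤ C) (h0 : 0 < e) (h1 : e ≤ 1) (k : ℕ) :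
    ∑ j ∈ Finset.range (k+1), e^j * (1-e)^(k-j) * (k.choose j : ℝ) * (C/((j:ℝ)+1))
      ≤ (C/e)/((k:ℝ)+1) := by
  have := mul_le_mul_of_nonneg_left (binom_neg_one k e h0 h1) hC
  rw [Finset.mul_sum] at this
  refine le_trans (le_of_eq ?_) (this.trans (le_of_eq ?_))
  · refine Finset.sum_congr rfl fun j _ => by ring
  · field_simp

lemma sum2 {C e : ℝ} (hC : 0 ≤ C) (h0 : 0 < e) (h1 : e ≤ 1) (k : ℕ) :
    ∑ j ∈ Finset.range (k+1), e^j * (1-e)^(k-j) * (k.choose j : ℝ) * (C/(((j:ℝ)+1)*(j+2)))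
      ≤ (C/e^2)/(((k:ℝ)+1)*(k+2)) := by
  have := mul_le_mul_of_nonneg_left (binom_neg_two k e h0 h1) hC
  rw [Finset.mul_sum] at this
  refine le_trans (le_of_eq ?_) (this.trans (le_of_eq ?_))
  · refine Finset.sum_congr rfl fun j _ => by ring
  · field_simp

lemma telescope (A B : R) (n : ℕ) :
    A^n - B^n = ∑ k ∈ Finset.range n, A^k * (A - B) * B^(n-1-k) := by
  have : ∀ k ∈ Finset.range n, A^k * (A - B) * B^(n-1-k) =
      A^(k+1) * B^(n-(k+1)) - A^k * B^(n-k) := by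
    intro k hk
    have hk := Finset.mem_range.1 hk
    rw [show n - 1 - k = n - (k+1) by omega, show n - k = (n-(k+1)) + 1 by omega, pow_succ,
      pow_succ']
    noncomm_ring
  rw [Finset.sum_congr rfl this, Finset.sum_range_sub (fun k => A^k * B^(n-k))]
  simp

lemma telescope' (A B c : R) (n : ℕ) :
    A^n * c - c * B^n = ∑ k ∈ Finset.range n, A^k * (A * c - c * B) * B^(n-1-k) := by
  have : ∀ k ∈ Finset.range n, A^k * (A * c - c * B) * B^(n-1-k) =
      A^(k+1) * c * B^(n-(k+1)) - A^k * c * B^(n-k) := by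
    intro k hk
    have hk := Finset.mem_range.1 hk
    rw [show n - 1 - k = n - (k+1) by omega, show n - k = (n-(k+1)) + 1 by omega, pow_succ A,
      pow_succ' B]
    noncomm_ring
  rw [Finset.sum_congr rfl this, Finset.sum_range_sub (fun k => A^k * c * B^(n-k))]
  simp

lemma sum_small {A B x : R} (hA : ‖A‖ ≤ 1) (hB : ‖B‖ ≤ 1) {C : ℝ}
    (h1 : ∀ k : ℕ, ‖A^k * x‖ ≤ C/(((k:ℝ)+1)*(k+2)))
    (h2 : ∀ k : ℕ, ‖x * B^k‖ ≤ C/(((k:ℝ)+1)*(k+2))) (n : ℕ) :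
    ‖∑ k ∈ Finset.range n, A^k * x * B^(n-1-k)‖ ≤ 4*C/((n:ℝ)+1) := by
  have hC : 0 ≤ C := by
    have := (norm_nonneg _).trans (h1 0)
    norm_num at this
    linarith
  have key : ∀ k ∈ Finset.range n, ‖A^k * x * B^(n-1-k)‖ ≤ 4*C/((n:ℝ)+1)^2 := by
    intro k hk
    have hk := Finset.mem_range.1 hk
    have bd : ∀ m : ℕ, n ≤ 2*m+1 → C/(((m:ℝ)+1)*(m+2)) ≤ 4*C/((n:ℝ)+1)^2 := by
      intro m hm
      have hm' : (n:ℝ) ≤ 2*m+1 := by exact_mod_cast hm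
      rw [div_le_div_iff₀ (by positivity) (by positivity)]
      have : ((n:ℝ)+1)^2 ≤ 4*((m+1)*(m+2)) := by nlinarith
      nlinarith
    by_cases h : n ≤ 2*k+1
    · refine le_trans ?_ (bd k h)
      refine (norm_mul_le _ _).trans ?_
      calc _ ≤ ‖A^k*x‖ * 1 := by gcongr; exact npow_le hB _
        _ ≤ _ := by rw [mul_one]; exact h1 k
    · refine le_trans ?_ (bd (n-1-k) (by omega))
      rw [mul_assoc]
      refine (norm_mul_le _ _).trans ?_
      calc _ ≤ 1 * ‖x * B^(n-1-k)‖ := by gcongr; exact npow_le hA _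
        _ ≤ _ := by rw [one_mul]; exact h2 _
  refine (norm_sum_le_of_le _ key).trans ?_
  rw [Finset.sum_const, Finset.card_range, nsmul_eq_mul, mul_div_assoc', 
    div_le_div_iff₀ (by positivity) (by positivity)]
  have : (0:ℝ) ≤ n := by positivity
  nlinarith [mul_nonneg hC this, mul_nonneg (mul_nonneg hC this) this]

/-- Binomial smoothing. -/
lemma smoothing {w : R} (hw : ‖w‖ ≤ 1) (m : ℕ) :
    ‖(1 - w) * (((1:ℝ)/2) • (1 + w))^m‖^2 ≤ 4/((m:ℝ)+1) := by
  have hpoly : (1 - w) * (1 + w)^m = ∑ i ∈ Finset.range (m+2),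
      ((((m:ℝ)+1 - 2*i) * ((m+1).choose i : ℝ))/(m+1)) • w^i := by
    have e1 : (1 + w)^m = ∑ i ∈ Finset.range (m+1), (m.choose i : ℝ) • w^i := by
      rw [add_comm, (Commute.one_right w).add_pow]
      refine Finset.sum_congr rfl fun i _ => ?_
      rw [one_pow, mul_one, ← Nat.cast_comm, ← nsmul_eq_mul, Nat.cast_smul_eq_nsmul ℝ]
    rw [sub_mul, one_mul, e1, Finset.mul_sum]
    have e2 : ∑ i ∈ Finset.range (m+1), (m.choose i : ℝ) • w^i
        = ∑ i ∈ Finset.range (m+2), (m.choose i : ℝ) • w^i := by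
      rw [Finset.sum_range_succ _ (m+1)]; simp
    rw [e2, Finset.sum_range_succ', Finset.sum_range_succ' _ (m+1), add_sub_right_comm,
      ← Finset.sum_sub_distrib]
    congr 1
    · refine Finset.sum_congr rfl fun i _ => ?_
      rw [mul_smul_comm, ← pow_succ', ← sub_smul]
      congr 1
      have hc : ((m:ℝ)+1) * (m.choose i) = ((m+1).choose (i+1) : ℝ) * (i+1) := by
        exact_mod_cast Nat.add_one_mul_choose_eq m i
      have hp : ((m+1).choose (i+1) : ℝ) = m.choose i + m.choose (i+1) := by
        exact_mod_cast Nat.choose_succ_succ m i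
      rw [eq_div_iff (by positivity)]
      push_cast
      linear_combination (-2) * hc - ((m:ℝ)+1) * hp
    · simp
      rw [div_self (by positivity), one_smul]
  have hvar : ∑ i ∈ Finset.range (m+2), ((m:ℝ)+1 - 2*i)^2 * ((m+1).choose i : ℝ)
      = ((m:ℝ)+1) * 2^(m+1) := by
    have h := congrArg (Polynomial.eval ((1:ℝ)/2)) (bernsteinPolynomial.variance ℝ (m+1))
    simp only [Polynomial.eval_finsetSum, bernsteinPolynomial, Polynomial.eval_mul,
      Polynomial.eval_pow, Polynomial.eval_sub, Polynomial.eval_X, Polynomial.eval_one,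
      Polynomial.eval_natCast, nsmul_eq_mul] at h
    have h' := congrArg (fun t => t * (4 * 2^(m+1))) h
    simp only [Finset.sum_mul] at h'
    refine Eq.trans (Finset.sum_congr rfl fun i hi => ?_) (h'.trans ?_)
    · have hi : i ≤ m+1 := by have := Finset.mem_range.1 hi; omega
      have : (2:ℝ)^(m+1) = 2^i * 2^(m+1-i) := by rw [← pow_add]; congr 1; omega
      rw [this, show (1:ℝ) - 1/2 = 1/2 by norm_num, div_pow, div_pow, one_pow, one_pow]
      push_cast
      field_simp
      ring
    · push_cast; ring
  have hsum : ∑ i ∈ Finset.range (m+2), ((m+1).choose i : ℝ) = 2^(m+1) := by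
    exact_mod_cast Nat.sum_range_choose (m+1)
  rw [smul_pow, mul_smul_comm, hpoly, norm_smul]
  set X := ∑ i ∈ Finset.range (m+2), |((m:ℝ)+1 - 2*i)| * ((m+1).choose i : ℝ) with hX
  have hn : ‖∑ i ∈ Finset.range (m+2),
      ((((m:ℝ)+1 - 2*i) * ((m+1).choose i : ℝ))/(m+1)) • w^i‖ ≤ X / (m+1) := by
    rw [hX, Finset.sum_div]
    refine norm_sum_le_of_le _ fun i _ => ?_
    rw [norm_smul, Real.norm_eq_abs, abs_div, abs_mul, Nat.abs_cast, abs_of_pos (show (0:ℝ) < m+1 by positivity)]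
    exact mul_le_of_le_one_right (by positivity) (npow_le hw i)
  have hX2 : X^2 ≤ (m+1) * (2^(m+1))^2 := by
    have := Finset.sum_mul_sq_le_sq_mul_sq (Finset.range (m+2))
      (fun i => |((m:ℝ)+1 - 2*i)| * √((m+1).choose i : ℝ)) (fun i => √((m+1).choose i : ℝ))
    simp only [mul_pow, sq_abs, mul_assoc] at this
    simp only [Real.sq_sqrt (Nat.cast_nonneg _), Real.mul_self_sqrt (Nat.cast_nonneg _)] at this
    rw [hvar, hsum] at this
    calc _ ≤ _ := this
      _ = _ := by ring
  have hX0 : 0 ≤ X := Finset.sum_nonneg fun i _ => by positivity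
  calc _ ≤ (((1:ℝ)/2)^m * (X/(m+1)))^2 := by
        rw [Real.norm_of_nonneg (by positivity)]
        gcongr
    _ = ((1:ℝ)/2)^(2*m) / (m+1)^2 * X^2 := by
      rw [mul_pow, div_pow X, ← pow_mul, mul_comm m 2]; ring
    _ ≤ ((1:ℝ)/2)^(2*m) / (m+1)^2 * ((m+1) * (2^(m+1))^2) := by gcongr
    _ = _ := by
      field_simp
      rw [div_pow, one_pow]
      field_simp
      ring

lemma nsmul_le' {x : R} {r : ℝ} (hr : 0 ≤ r) (hx : ‖x‖ ≤ 1) : ‖r • x‖ ≤ r := by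
  rw [norm_smul, Real.norm_of_nonneg hr]
  exact mul_le_of_le_one_right hr hx

/-- The symmetric and antisymmetric halves of a pair of involutions. -/
structure Half (p q : R) : Prop where
  anti : p * q = -(q * p)
  sq : p * p = 1 - q * q
  np : ‖p‖ ≤ 1
  nq : ‖q‖ ≤ 1
  sm : ∀ m : ℕ, ‖q * p^m‖^2 ≤ 2/((m:ℝ)+1)

lemma half_of_inv {a b : R} (ha : a * a = 1) (hb : b * b = 1) (na : ‖a‖ ≤ 1) (nb : ‖b‖ ≤ 1) :
    Half (((1:ℝ)/2) • (a + b)) (((1:ℝ)/2) • (a - b)) := by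
  have np : ‖((1:ℝ)/2) • (a + b)‖ ≤ 1 := by
    rw [norm_smul, Real.norm_of_nonneg (by norm_num)]
    linarith [norm_add_le a b]
  have nq : ‖((1:ℝ)/2) • (a - b)‖ ≤ 1 := by
    rw [norm_smul, Real.norm_of_nonneg (by norm_num)]
    linarith [norm_sub_le a b]
  have ha' : ∀ x, a * (a * x) = x := fun x => by rw [← mul_assoc, ha, one_mul]
  have hb' : ∀ x, b * (b * x) = x := fun x => by rw [← mul_assoc, hb, one_mul]
  refine ⟨?_, ?_, np, nq, ?_⟩
  · simp only [smul_mul_assoc, mul_smul_comm, mul_add, add_mul, mul_sub, sub_mul, ha, hb]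
    module
  · simp only [smul_mul_assoc, mul_smul_comm, mul_add, add_mul, mul_sub, sub_mul, ha, hb]
    module
  · set p := ((1:ℝ)/2) • (a + b) with hp
    set q := ((1:ℝ)/2) • (a - b) with hq
    set S := ((1:ℝ)/2) • (1 + a * b) with hS
    have c1 : Commute (b * a) (a * b) := by
      simp only [Commute, SemiconjBy, mul_assoc, ha, hb, ha', hb']
    have c2 : Commute (b * a) S := ((Commute.one_right _).add_right c1).smul_right _
    have c3 : Commute (b * a) (1 - a * b) := (Commute.one_right _).sub_right c1
    have hpp : p * p = (b * a) * (S * S) := by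
      rw [hp, hS]
      simp only [smul_mul_assoc, mul_smul_comm, mul_add, add_mul, mul_sub, sub_mul, ha, hb,
        mul_assoc, ha', hb', mul_one, one_mul]
      module
    have hqq : q = ((1:ℝ)/2) • (a * (1 - a * b)) := by
      rw [hq, mul_sub, ha', mul_one]
    have even : ∀ k : ℕ, ‖q * p^(2*k)‖^2 ≤ 1/(2*(k:ℝ)+1) := by
      intro k
      have e : q * p^(2*k) = ((1:ℝ)/2) • (a * ((b*a)^k * ((1 - a*b) * S^(2*k)))) := by
        rw [pow_mul, pow_two, hpp, (c2.mul_right c2).mul_pow, hqq, smul_mul_assoc, pow_mul, pow_two]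
        congr 1
        rw [mul_assoc, ← mul_assoc (1 - a*b), ← (c3.pow_left k).eq, mul_assoc]
      have hs := smoothing (nmul_le na nb) (2*k)
      have l : ‖q * p^(2*k)‖ ≤ 1/2 * ‖(1 - a*b) * S^(2*k)‖ := by
        rw [e, norm_smul, Real.norm_of_nonneg (by norm_num)]
        have l1 := norm_mul_le a ((b*a)^k * ((1 - a*b) * S^(2*k)))
        have l2 := norm_mul_le ((b*a)^k) ((1 - a*b) * S^(2*k))
        have l3 := npow_le (nmul_le nb na) k
        have l4 := mul_le_of_le_one_left (norm_nonneg ((1 - a*b) * S^(2*k))) l3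
        have l5 := mul_le_of_le_one_left (norm_nonneg ((b*a)^k * ((1 - a*b) * S^(2*k)))) na
        linarith
      calc _ ≤ (1/2 * ‖(1 - a*b) * S^(2*k)‖)^2 := by gcongr
        _ = 1/4 * ‖(1 - a*b) * S^(2*k)‖^2 := by ring
        _ ≤ 1/4 * (4/(((2*k:ℕ):ℝ)+1)) := by gcongr
        _ = _ := by push_cast; field_simp
    intro m
    obtain ⟨k, hk | hk⟩ := Nat.even_or_odd' m
    · rw [hk]
      refine (even k).trans ?_
      push_cast
      gcongr
      norm_num
    · have : ‖q * p^m‖ ≤ ‖q * p^(2*k)‖ := by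
        rw [hk, pow_succ, ← mul_assoc]
        exact (norm_mul_le _ _).trans (mul_le_of_le_one_right (norm_nonneg _) np)
      calc _ ≤ ‖q * p^(2*k)‖^2 := by gcongr
        _ ≤ _ := even k
        _ ≤ _ := by
          rw [hk]
          push_cast
          rw [div_le_div_iff₀ (by positivity) (by positivity)]
          nlinarith [(Nat.cast_nonneg k : (0:ℝ) ≤ k)]

lemma Half.comm {p q : R} (h : Half p q) (r k : ℕ) :
    q^r * p^k = p^k * q^r ∨ q^r * p^k = -(p^k * q^r) := by
  have h1 : SemiconjBy q p (-p) := by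
    rw [SemiconjBy, neg_mul, h.anti, neg_neg]
  have h2 : q * p^k = p^k * q ∨ q * p^k = -(p^k * q) := by
    have := (h1.pow_right k).eq
    rw [this]
    rcases Nat.even_or_odd k with hk | hk
    · rw [hk.neg_pow]; left; rfl
    · rw [hk.neg_pow]; right; rw [neg_mul]
  induction r with
  | zero => left; simp
  | succ r ih =>
    rw [pow_succ]
    rcases h2 with h2 | h2 <;> rcases ih with ih | ih
    · left; rw [mul_assoc, h2, ← mul_assoc, ih, mul_assoc]
    · right; rw [mul_assoc, h2, ← mul_assoc, ih, neg_mul, mul_assoc]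
    · right; rw [mul_assoc, h2, mul_neg, ← mul_assoc, ih, mul_assoc]
    · left; rw [mul_assoc, h2, mul_neg, ← mul_assoc, ih, neg_mul, neg_neg, mul_assoc]

lemma Half.norm_comm {p q : R} (h : Half p q) (r k : ℕ) : ‖p^k * q^r‖ = ‖q^r * p^k‖ := by
  rcases h.comm r k with h | h <;> rw [h]
  rw [norm_neg]

lemma Half.norm_pow {p q : R} (h : Half p q) (r k l : ℕ) :
    ‖q^r * p^(r*k+l)‖ ≤ ‖q * p^k‖^r := by
  induction r with
  | zero => simpa using npow_le h.np l
  | succ r ih =>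
    have e : ‖q^(r+1) * p^((r+1)*k+l)‖ = ‖(q * p^k) * (q^r * p^(r*k+l))‖ := by
      rw [show (r+1)*k+l = k + (r*k+l) by ring, pow_succ', pow_add p k, mul_assoc,
        ← mul_assoc (q^r)]
      rcases h.comm r k with h | h <;> rw [h]
      · simp only [mul_assoc]
      · simp only [mul_assoc, neg_mul, mul_neg, norm_neg]
    rw [e, pow_succ']
    exact (norm_mul_le _ _).trans (by gcongr)

lemma Half.decay {p q : R} (h : Half p q) (r m : ℕ) (hr : 0 < r) :
    ‖p^m * q^r‖^2 ≤ (2*r/((m:ℝ)+1))^r := by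
  rw [h.norm_comm]
  have h1 := h.norm_pow r (m/r) (m % r)
  rw [Nat.div_add_mod] at h1
  calc _ ≤ (‖q * p^(m/r)‖^r)^2 := by gcongr
    _ = (‖q * p^(m/r)‖^2)^r := by ring
    _ ≤ _ := by
      refine pow_le_pow_left₀ (by positivity) ((h.sm _).trans ?_) _
      rw [div_le_div_iff₀ (by positivity) (by positivity)]
      have : m + 1 ≤ r * (m/r + 1) := by
        have := Nat.div_add_mod m r
        have := Nat.mod_lt m hr
        rw [mul_add]; omega
      have : (m:ℝ) + 1 ≤ r * ((m/r : ℕ) + 1) := by exact_mod_cast this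
      nlinarith

lemma inv_sq_le {x C : ℝ} (m : ℕ) (hC : 0 ≤ C) (h : x ≤ C/((m:ℝ)+1)^2) :
    x ≤ 2*C/(((m:ℝ)+1)*(m+2)) := by
  refine h.trans ?_
  rw [div_le_div_iff₀ (by positivity) (by positivity)]
  have : (0:ℝ) ≤ m := by positivity
  nlinarith [mul_nonneg hC this, mul_nonneg (mul_nonneg hC this) this]

/-- `((1+w)/2)^m * (1-w)^r` decays. -/
lemma smoothing_two {w : R} (hw : ‖w‖ ≤ 1) (m : ℕ) :
    ‖(((1:ℝ)/2) • (1 + w))^m * ((1 - w) * (1 - w))‖ ≤ 8/((m:ℝ)+1) := by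
  set S := ((1:ℝ)/2) • (1 + w) with hS
  have nS : ‖S‖ ≤ 1 := by
    rw [hS, norm_smul, Real.norm_of_nonneg (by norm_num)]
    have := norm_add_le (1:R) w
    rw [norm_one] at this
    linarith
  have c : Commute (1 - w) S := by
    refine Commute.smul_right ?_ _
    exact ((Commute.one_left _).add_right (Commute.one_left _)).sub_left
      ((Commute.one_right _).add_right (Commute.refl _))
  set k := m/2
  have hk : m + 1 ≤ 2 * (k+1) := by omega
  have hk' : (m:ℝ)+1 ≤ 2*(k+1) := by exact_mod_cast hk
  have e : S^m * ((1 - w) * (1 - w)) = S^(m - 2*k) * (((1-w) * S^k) * ((1-w) * S^k)) := by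
    conv_lhs => rw [show m = (m - 2*k) + (k + k) by omega, pow_add, pow_add]
    have := (c.pow_right k).eq
    rw [this]
    simp only [mul_assoc]
    rw [← mul_assoc (1-w) (S^k) (1-w), this]
    simp only [mul_assoc]
  have hs := smoothing hw k
  rw [← hS] at hs
  rw [e]
  have l1 := norm_mul_le (S^(m - 2*k)) (((1-w) * S^k) * ((1-w) * S^k))
  have l2 := mul_le_of_le_one_left (norm_nonneg (((1-w) * S^k) * ((1-w) * S^k))) (npow_le nS (m-2*k))
  have l3 := norm_mul_le ((1-w) * S^k) ((1-w) * S^k)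
  have l4 : 4/((k:ℝ)+1) ≤ 8/((m:ℝ)+1) := by
    rw [div_le_div_iff₀ (by positivity) (by positivity)]
    linarith
  nlinarith

/-- The decay of `((1+2p)/3)^j (1-p)`. -/
lemma Half.mu_decay {p q : R} (h : Half p q) (j : ℕ) :
    ‖(((1:ℝ)/3) • (1 + (2:ℝ) • p))^j * (1 - p)‖ ≤ 9/((j:ℝ)+1) := by
  set μ := ((1:ℝ)/3) • (1 + (2:ℝ) • p) with hμ
  have e : μ^j * (1 - p) = ((1:ℝ)/2) • (μ^j * q^2) + ((1:ℝ)/2) • (μ^j * ((1-p)*(1-p))) := by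
    rw [← smul_add, ← mul_add, ← mul_smul_comm]
    congr 1
    have : q^2 = 1 - p*p := by rw [h.sq, pow_two]; abel
    rw [this]
    simp only [mul_sub, sub_mul, mul_one, one_mul]
    module
  have h1 : ‖μ^j * q^2‖ ≤ (4/(2/3))/((j:ℝ)+1) := by
    have : μ = ((2:ℝ)/3) • p + ((1:ℝ)/3) • 1 := by rw [hμ]; module
    rw [this]
    refine (mix_left (by norm_num) (by norm_num) ((Commute.one_right p).smul_right _) ?_ (fun i => 4/((i:ℝ)+1)) ?_ j).trans (sum1 (by norm_num) (by norm_num) (by norm_num) j)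
    · refine (nsmul_le' (by norm_num) (by simp)).trans (by norm_num)
    · intro i
      have := h.decay 2 i (by norm_num)
      push_cast at this
      refine le_of_sq_le_sq ?_ (by positivity)
      refine this.trans (le_of_eq (by ring))
  have h2 : ‖μ^j * ((1-p)*(1-p))‖ ≤ (8/(2/3))/((j:ℝ)+1) := by
    have : μ = ((2:ℝ)/3) • (((1:ℝ)/2) • (1 + p)) + ((1:ℝ)/3) • p := by rw [hμ]; module
    rw [this]
    refine (mix_left (by norm_num) (by norm_num) ?_ ?_ (fun i => 8/((i:ℝ)+1)) (fun i => smoothing_two h.np i) j).trans (sum1 (by norm_num) (by norm_num) (by norm_num) j)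
    · exact ((((Commute.one_left p).add_left (Commute.refl p)).smul_left _).smul_right _)
    · refine (nsmul_le' (by norm_num) h.np).trans (by norm_num)
  rw [e]
  refine (norm_add_le _ _).trans ?_
  rw [norm_smul, norm_smul, Real.norm_of_nonneg (by norm_num)]
  have : (9:ℝ)/(j+1) = 1/2 * ((4/(2/3))/((j:ℝ)+1)) + 1/2 * ((8/(2/3))/((j:ℝ)+1)) := by
    field_simp; norm_num
  rw [this]
  gcongr

/-- Two commuting halves. -/
structure Quad (p q p' q' : R) : Prop where
  h : Half p q
  h' : Half p' q'
  cpp : Commute p p'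
  cpq : Commute p q'
  cqp : Commute q p'
  cqq : Commute q q'
  nuz : ‖p * p' + q * q'‖ ≤ 1

namespace Quad
variable {p q p' q' : R} (Q : Quad p q p' q')
include Q

lemma upow (i r s : ℕ) : (p * p')^i * (q^r * q'^s) = (p^i * q^r) * (p'^i * q'^s) := by
  rw [Q.cpp.mul_pow, mul_assoc, mul_assoc, ← mul_assoc (p'^i), (Q.cqp.symm.pow_pow i r).eq,
    mul_assoc]

lemma nu : ‖p * p'‖ ≤ 1 := nmul_le Q.h.np Q.h'.np

lemma decay1 (i : ℕ) : ‖(p*p')^i * (q^1 * q'^1)‖ ≤ 2/((i:ℝ)+1) := by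
  rw [Q.upow]
  refine (norm_mul_le _ _).trans ?_
  refine le_of_sq_le_sq ?_ (by positivity)
  have h1 := Q.h.decay 1 i (by norm_num)
  have h2 := Q.h'.decay 1 i (by norm_num)
  rw [mul_pow]
  calc _ ≤ (2*(1:ℕ)/((i:ℝ)+1))^1 * (2*(1:ℕ)/((i:ℝ)+1))^1 := by gcongr
    _ = _ := by push_cast; ring

lemma decay2 (i r s : ℕ) (hrs : (r = 1 ∧ s = 3) ∨ (r = 2 ∧ s = 2) ∨ (r = 3 ∧ s = 1)) :
    ‖(p*p')^i * (q^r * q'^s)‖ ≤ 42/(((i:ℝ)+1)*(i+2)) := by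
  rw [Q.upow, show (42:ℝ) = 2*21 by norm_num]
  refine inv_sq_le _ (by norm_num) ?_
  refine (norm_mul_le _ _).trans ?_
  refine le_of_sq_le_sq ?_ (by positivity)
  rw [mul_pow]
  have h1 := Q.h.decay r i (by omega)
  have h2 := Q.h'.decay s i (by omega)
  calc _ ≤ (2*r/((i:ℝ)+1))^r * (2*s/((i:ℝ)+1))^s := by gcongr
    _ ≤ _ := by
      have hp : (0:ℝ) < ((i:ℝ)+1)^4 := by positivity
      rcases hrs with ⟨rfl, rfl⟩ | ⟨rfl, rfl⟩ | ⟨rfl, rfl⟩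
      all_goals
        simp only [div_pow, ← pow_mul, div_mul_div_comm, ← pow_add]
        norm_num
        gcongr
        norm_num

/-- central lazy element -/
lemma S_eq : ((1:ℝ)/2) • (1 + p * p') = ((1:ℝ)/2) • (p * p') + ((1:ℝ)/2) • 1 := by module

lemma Sdecay1 (j : ℕ) : ‖(((1:ℝ)/2) • (1 + p * p'))^j * (q^1 * q'^1)‖ ≤ 4/((j:ℝ)+1) := by
  rw [Q.S_eq]
  refine (mix_left (by norm_num) (by norm_num) ((Commute.one_right _).smul_right _) ?_
    (fun i => 2/((i:ℝ)+1)) (fun i => Q.decay1 i) j).trans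
    ((sum1 (by norm_num) (by norm_num) (by norm_num) j).trans (le_of_eq (by norm_num)))
  exact (nsmul_le' (by norm_num) (by simp)).trans (by norm_num)

lemma Sdecay2 (j r s : ℕ) (hrs : (r = 1 ∧ s = 3) ∨ (r = 2 ∧ s = 2) ∨ (r = 3 ∧ s = 1)) :
    ‖(((1:ℝ)/2) • (1 + p * p'))^j * (q^r * q'^s)‖ ≤ 168/(((j:ℝ)+1)*(j+2)) := by
  rw [Q.S_eq]
  refine (mix_left (by norm_num) (by norm_num) ((Commute.one_right _).smul_right _) ?_
    (fun i => 42/(((i:ℝ)+1)*(i+2))) (fun i => Q.decay2 i r s hrs) j).trans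
    ((sum2 (by norm_num) (by norm_num) (by norm_num) j).trans (le_of_eq (by norm_num)))
  exact (nsmul_le' (by norm_num) (by simp)).trans (by norm_num)

lemma nS : ‖((1:ℝ)/2) • (1 + p * p')‖ ≤ 1 := by
  rw [norm_smul, Real.norm_of_nonneg (by norm_num)]
  have := norm_add_le (1:R) (p*p')
  rw [norm_one] at this
  linarith [Q.nu]

lemma Sdecay3 (j : ℕ) :
    ‖(((1:ℝ)/2) • (1 + p * p'))^j * (((1 - p*p') * (1 - p*p')) * (q^1 * q'^1))‖
      ≤ 256/(((j:ℝ)+1)*(j+2)) := by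
  rw [show (256:ℝ) = 2*128 by norm_num]
  refine inv_sq_le _ (by norm_num) ?_
  set S := ((1:ℝ)/2) • (1 + p * p') with hS
  set w := 1 - p*p' with hw
  have c : Commute w S := by
    refine Commute.smul_right ?_ _
    exact ((Commute.one_left _).add_right (Commute.one_left _)).sub_left
      ((Commute.one_right _).add_right (Commute.refl _))
  set k := j/2
  have hk : j + 1 ≤ 2 * (k+1) := by omega
  have hk' : (j:ℝ)+1 ≤ 2*(k+1) := by exact_mod_cast hk
  have e : S^j * ((w * w) * (q^1 * q'^1)) =
      S^(j-2*k) * ((S^k * (w*w)) * (S^k * (q^1*q'^1))) := by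
    conv_lhs => rw [show j = (j - 2*k) + (k + k) by omega, pow_add, pow_add]
    have := ((c.mul_left c).pow_right k).eq
    simp only [mul_assoc] at this ⊢
    rw [← mul_assoc w (S^k), ← mul_assoc w (w * S^k), this]
    simp only [mul_assoc]
  rw [e]
  have h1 := smoothing_two Q.nu k
  have h2 := Q.Sdecay1 k
  rw [← hS] at h1 h2
  rw [← hw] at h1
  have l1 := norm_mul_le (S^(j-2*k)) ((S^k * (w*w)) * (S^k * (q^1*q'^1)))
  have l2 := mul_le_of_le_one_left (norm_nonneg ((S^k * (w*w)) * (S^k * (q^1*q'^1))))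
    (npow_le Q.nS (j-2*k))
  have l3 := norm_mul_le (S^k * (w*w)) (S^k * (q^1*q'^1))
  calc _ ≤ ‖S^k * (w*w)‖ * ‖S^k * (q^1*q'^1)‖ := by linarith
    _ ≤ (8/((k:ℝ)+1)) * (4/((k:ℝ)+1)) := by gcongr
    _ ≤ _ := by
      rw [div_mul_div_comm, div_le_div_iff₀ (by positivity) (by positivity)]
      nlinarith [(Nat.cast_nonneg j : (0:ℝ) ≤ j)]

/-- the remainder -/
lemma rem_decay (d : ℝ) : ∃ C : ℝ, 0 ≤ C ∧ ∀ j : ℕ,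
    ‖(((1:ℝ)/2) • (1 + p * p'))^j * (
      ((1:ℝ)/4) • (((1 - p*p') * (1 - p*p')) * (q^1 * q'^1))
      + ((1:ℝ)/8) • (((3:ℝ) • 1 - p*p') * (q^3 * q'^1 + q^1 * q'^3))
      + d • (((p + p') * ((3:ℝ) • 1 - p*p')) * (q^2 * q'^2)))‖ ≤ C/(((j:ℝ)+1)*(j+2)) := by
  refine ⟨(1/4)*256 + (1/8)*(4*(168+168)) + |d| *(8*168), by positivity, fun j => ?_⟩
  set S := ((1:ℝ)/2) • (1 + p * p') with hS
  have cu : Commute S (p*p') := ((Commute.one_left _).add_left (Commute.refl _)).smul_left _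
  have cp : Commute S p := ((Commute.one_left _).add_left
    ((Commute.refl p).mul_left Q.cpp.symm)).smul_left _
  have cp' : Commute S p' := ((Commute.one_left _).add_left
    (Q.cpp.mul_left (Commute.refl p'))).smul_left _
  have c3 : Commute S ((3:ℝ) • 1 - p*p') := ((Commute.one_right _).smul_right _).sub_right cu
  have c4 : Commute S ((p+p') * ((3:ℝ) • 1 - p*p')) := (cp.add_right cp').mul_right c3
  have n3 : ‖(3:ℝ) • (1:R) - p*p'‖ ≤ 4 := by
    have := norm_sub_le ((3:ℝ) • (1:R)) (p*p')
    have := nsmul_le' (x := (1:R)) (r := 3) (by norm_num) (by simp)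
    linarith [Q.nu]
  have n4 : ‖(p+p') * ((3:ℝ) • 1 - p*p')‖ ≤ 8 := by
    have h1 := norm_add_le p p'
    have h2 := Q.h.np
    have h3 := Q.h'.np
    have h4 := norm_mul_le (p+p') ((3:ℝ) • 1 - p*p')
    nlinarith [norm_nonneg (p+p'), norm_nonneg ((3:ℝ) • (1:R) - p*p')]
  rw [mul_add, mul_add, mul_smul_comm, mul_smul_comm, mul_smul_comm]
  have t1 := Q.Sdecay3 j
  have t2 := Q.Sdecay2 j 3 1 (by simp)
  have t3 := Q.Sdecay2 j 1 3 (by simp)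
  have t4 := Q.Sdecay2 j 2 2 (by simp)
  rw [← hS] at t1 t2 t3 t4
  have e2 : ‖S^j * (((3:ℝ) • 1 - p*p') * (q^3 * q'^1 + q^1 * q'^3))‖ ≤
      4 * (168/(((j:ℝ)+1)*(j+2)) + 168/(((j:ℝ)+1)*(j+2))) := by
    rw [← mul_assoc, (c3.pow_left j).eq, mul_assoc, mul_add]
    refine (norm_mul_le _ _).trans ?_
    gcongr
    exact (norm_add_le _ _).trans (add_le_add t2 t3)
  have e3 : ‖S^j * (((p + p') * ((3:ℝ) • 1 - p*p')) * (q^2 * q'^2))‖ ≤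
      8 * (168/(((j:ℝ)+1)*(j+2))) := by
    rw [← mul_assoc, (c4.pow_left j).eq, mul_assoc]
    refine (norm_mul_le _ _).trans ?_
    gcongr
  refine (norm_add₃_le).trans ?_
  rw [norm_smul, norm_smul, norm_smul, Real.norm_of_nonneg (show (0:ℝ) ≤ 1/4 by norm_num),
    Real.norm_of_nonneg (show (0:ℝ) ≤ 1/8 by norm_num), Real.norm_eq_abs]
  calc _ ≤ 1/4 * (256/(((j:ℝ)+1)*(j+2))) + 1/8 * (4 * (168/(((j:ℝ)+1)*(j+2)) + 168/(((j:ℝ)+1)*(j+2)))) + |d| * (8 * (168/(((j:ℝ)+1)*(j+2)))) := by gcongr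
    _ = _ := by ring

end Quad

/-- The commutative part of the noise kernel. -/
noncomputable def alphaE (p p' : R) (ρ : ℝ) : R :=
  ((1-ρ)/3) • (1 + (2:ℝ) • (p * p')) + (ρ/9) • ((1 + (2:ℝ) • p) * (1 + (2:ℝ) • p'))

/-- The noise kernel. -/
noncomputable def piE (p q p' q' : R) (ρ : ℝ) : R := alphaE p p' ρ + (2*(1-ρ)/3) • (q * q')

/-- The product kernel. -/
noncomputable def sigmaE (p p' : R) : R :=
  (((1:ℝ)/3) • (1 + (2:ℝ) • p)) * (((1:ℝ)/3) • (1 + (2:ℝ) • p'))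

namespace Quad
variable {p q p' q' : R} (Q : Quad p q p' q')
include Q

lemma step2 {ρ : ℝ} (h0 : 0 < ρ) (h1 : ρ < 1) : ∃ C : ℝ, ∀ n : ℕ,
    ‖(alphaE p p' ρ)^n - (sigmaE p p')^n‖ ≤ C/((n:ℝ)+1) := by
  set μ := ((1:ℝ)/3) • (1 + (2:ℝ) • p) with hμ
  set μ' := ((1:ℝ)/3) • (1 + (2:ℝ) • p') with hμ'
  set σ := sigmaE p p' with hσ
  have hσ' : σ = μ * μ' := rfl
  have cpμ' : Commute p μ' := ((Commute.one_right _).add_right (Q.cpp.smul_right _)).smul_right _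
  have cpμ : Commute p μ :=
    ((Commute.one_right _).add_right ((Commute.refl p).smul_right _)).smul_right _
  have cp'μ' : Commute p' μ' :=
    ((Commute.one_right _).add_right ((Commute.refl p').smul_right _)).smul_right _
  have cp'μ : Commute p' μ :=
    ((Commute.one_right _).add_right (Q.cpp.symm.smul_right _)).smul_right _
  have cμμ' : Commute μ μ' :=
    ((Commute.one_left _).add_left (cpμ'.smul_left _)).smul_left _
  have cpσ : Commute p σ := cpμ.mul_right cpμ'
  have cp'σ : Commute p' σ := cp'μ.mul_right cp'μ'
  have nμ : ∀ x : R, ‖x‖ ≤ 1 → ‖((1:ℝ)/3) • (1 + (2:ℝ) • x)‖ ≤ 1 := by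
    intro x hx
    rw [norm_smul, Real.norm_of_nonneg (by norm_num)]
    have := norm_add_le (1:R) ((2:ℝ) • x)
    have := nsmul_le' (r := 2) (by norm_num) hx
    rw [norm_one] at *
    linarith
  have nσ : ‖σ‖ ≤ 1 := nmul_le (nμ _ Q.h.np) (nμ _ Q.h'.np)
  set x := (1 - p) * (1 - p') with hx
  have cxσ : Commute x σ := ((Commute.one_left _).sub_left cpσ).mul_left
    ((Commute.one_left _).sub_left cp'σ)
  have hα : alphaE p p' ρ = ρ • σ + ((1-ρ)/3) • (1 + (2:ℝ) • (p * p')) := by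
    rw [alphaE, hσ, sigmaE]
    simp only [smul_mul_assoc, mul_smul_comm]
    module
  have nτ : ‖((1-ρ)/3) • (1 + (2:ℝ) • (p * p'))‖ ≤ 1 - ρ := by
    have := nμ _ Q.nu
    have := nsmul_le' (r := 1-ρ) (by linarith) this
    rw [smul_smul] at this
    rwa [div_eq_mul_one_div]
  have cτ : Commute σ (((1-ρ)/3) • (1 + (2:ℝ) • (p * p'))) :=
    ((Commute.one_right _).add_right ((cpσ.symm.mul_right cp'σ.symm).smul_right _)).smul_right _
  have nα : ‖alphaE p p' ρ‖ ≤ 1 := by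
    rw [hα]
    have := norm_add_le (ρ • σ) (((1-ρ)/3) • (1 + (2:ℝ) • (p * p')))
    have := nsmul_le' h0.le nσ
    linarith
  have dσ : ∀ j : ℕ, ‖σ^j * x‖ ≤ (2*81)/(((j:ℝ)+1)*(j+2)) := by
    intro j
    refine inv_sq_le _ (by norm_num) ?_
    have e : σ^j * x = (μ^j * (1-p)) * (μ'^j * (1-p')) := by
      have c : Commute (μ'^j) (1-p) := ((Commute.one_right _).sub_right cpμ'.symm).pow_left j
      rw [hσ', cμμ'.mul_pow, hx, mul_assoc, mul_assoc, ← mul_assoc (μ'^j), c.eq, mul_assoc]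
    rw [e]
    refine (norm_mul_le _ _).trans ?_
    have h1 := Q.h.mu_decay j
    have h2 := Q.h'.mu_decay j
    calc _ ≤ (9/((j:ℝ)+1)) * (9/((j:ℝ)+1)) := by gcongr
      _ = _ := by rw [div_mul_div_comm, pow_two]; norm_num
  have hρ2 : 2*81 ≤ (2*81)/ρ^2 := by
    rw [le_div_iff₀ (by positivity)]
    nlinarith
  have dα : ∀ k : ℕ, ‖(alphaE p p' ρ)^k * x‖ ≤ ((2*81)/ρ^2)/(((k:ℝ)+1)*(k+2)) := by
    intro k
    rw [hα]
    exact (mix_left h0 h1.le cτ nτ _ dσ k).trans (sum2 (by norm_num) h0 h1.le k)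
  have dσ' : ∀ k : ℕ, ‖x * σ^k‖ ≤ ((2*81)/ρ^2)/(((k:ℝ)+1)*(k+2)) := by
    intro k
    rw [(cxσ.pow_right k).eq]
    refine (dσ k).trans ?_
    gcongr
  have hdiff : alphaE p p' ρ - σ = (2*(1-ρ)/9) • x := by
    rw [alphaE, hσ, sigmaE, hx]
    simp only [smul_mul_assoc, mul_smul_comm, mul_add, add_mul, mul_sub, sub_mul, mul_one, one_mul]
    module
  refine ⟨(2*(1-ρ)/9) * (4*((2*81)/ρ^2)), fun n => ?_⟩
  rw [telescope, hdiff]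
  simp only [mul_smul_comm, smul_mul_assoc]
  rw [← Finset.smul_sum, norm_smul, Real.norm_of_nonneg (by linarith)]
  refine (mul_le_mul_of_nonneg_left (sum_small nα nσ dα dσ' n) (by linarith)).trans_eq ?_
  ring

lemma step1 {ρ : ℝ} (h0 : 0 < ρ) (h1 : ρ < 1) : ∃ C : ℝ, ∀ n : ℕ,
    ‖(piE p q p' q' ρ)^n - (alphaE p p' ρ)^n‖ ≤ C/((n:ℝ)+1) := by
  set A := piE p q p' q' ρ with hA
  set B := alphaE p p' ρ with hB
  set S := ((1:ℝ)/2) • (1 + p * p') with hS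
  set β := 2*(1-ρ)/3 with hβ
  set l := 9/(32*ρ) with hl
  set z := q * q' with hz
  set c := l • (((p + p') * ((3:ℝ) • 1 - p*p')) * z) with hc
  set e := ((1:ℝ)/4) • (((1 - p*p') * (1 - p*p')) * (q^1 * q'^1))
      + ((1:ℝ)/8) • (((3:ℝ) • 1 - p*p') * (q^3 * q'^1 + q^1 * q'^3))
      + (β*l) • (((p + p') * ((3:ℝ) • 1 - p*p')) * (q^2 * q'^2)) with he
  have r1 := Q.h.anti
  have r1' : ∀ x, p * (q * x) = -(q * (p * x)) := fun x => by
    rw [← mul_assoc, r1, neg_mul, mul_assoc]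
  have r2 := Q.h'.anti
  have r2' : ∀ x, p' * (q' * x) = -(q' * (p' * x)) := fun x => by
    rw [← mul_assoc, r2, neg_mul, mul_assoc]
  have s1 := Q.h.sq
  have s1' : ∀ x, p * (p * x) = x - q * (q * x) := fun x => by
    rw [← mul_assoc, s1, sub_mul, one_mul, mul_assoc]
  have s2 := Q.h'.sq
  have s2' : ∀ x, p' * (p' * x) = x - q' * (q' * x) := fun x => by
    rw [← mul_assoc, s2, sub_mul, one_mul, mul_assoc]
  have k1 : p' * p = p * p' := Q.cpp.symm.eq
  have k1' : ∀ x, p' * (p * x) = p * (p' * x) := fun x => by rw [← mul_assoc, k1, mul_assoc]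
  have k2 : q' * p = p * q' := Q.cpq.symm.eq
  have k2' : ∀ x, q' * (p * x) = p * (q' * x) := fun x => by rw [← mul_assoc, k2, mul_assoc]
  have k3 : p' * q = q * p' := Q.cqp.symm.eq
  have k3' : ∀ x, p' * (q * x) = q * (p' * x) := fun x => by rw [← mul_assoc, k3, mul_assoc]
  have k4 : q' * q = q * q' := Q.cqq.symm.eq
  have k4' : ∀ x, q' * (q * x) = q * (q' * x) := fun x => by rw [← mul_assoc, k4, mul_assoc]
  have key : A * c - c * B = z - e := by
    rw [hA, hB, piE, hc, he, hz, ← hβ, alphaE]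
    simp only [pow_one, pow_two, pow_succ, pow_zero, one_mul, mul_one]
    simp only [smul_mul_assoc, mul_smul_comm, mul_add, add_mul, mul_sub, sub_mul, mul_one, one_mul,
      mul_assoc, r1, r1', r2, r2', s1, s1', s2, s2', k1, k1', k2, k2', k3, k3', k4, k4', mul_neg,
      neg_mul, smul_add, smul_sub, smul_neg, neg_neg, smul_smul]
    simp only [hl]
    match_scalars <;> (field_simp <;> ring)
  have hE : 0 < 2*ρ/9 := by positivity
  have hE1 : 2*ρ/9 ≤ 1 := by linarith
  have cu : Commute S (p*p') := ((Commute.one_left _).add_left (Commute.refl _)).smul_left _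
  have cp : Commute S p := ((Commute.one_left _).add_left
    ((Commute.refl p).mul_left Q.cpp.symm)).smul_left _
  have cp' : Commute S p' := ((Commute.one_left _).add_left
    (Q.cpp.mul_left (Commute.refl p'))).smul_left _
  have cuq : ∀ r s : ℕ, Commute (p*p') (q^r * q'^s) → Commute S (q^r * q'^s) := fun r s h =>
    ((Commute.one_left _).add_left h).smul_left _
  have cuz : Commute (p*p') z := by
    rw [Commute, SemiconjBy, hz]
    simp only [mul_assoc, r1, r1', r2, r2', k1, k1', k2, k2', k3, k3', k4, k4', mul_neg, neg_neg]
  have cz : Commute S z := ((Commute.one_left _).add_left cuz).smul_left _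
  have cq2 : Commute S (q*q) := by
    have : q * q = 1 - p * p := by rw [s1]; abel
    rw [this]
    exact (Commute.one_right _).sub_right (cp.mul_right cp)
  have cq2' : Commute S (q'*q') := by
    have : q' * q' = 1 - p' * p' := by rw [s2]; abel
    rw [this]
    exact (Commute.one_right _).sub_right (cp'.mul_right cp')
  have c3 : Commute S ((3:ℝ) • 1 - p*p') := ((Commute.one_right _).smul_right _).sub_right cu
  have c1 : Commute S (1 - p*p') := (Commute.one_right _).sub_right cu
  have c4 : Commute S ((p+p') * ((3:ℝ) • 1 - p*p')) := (cp.add_right cp').mul_right c3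
  have ce : Commute S e := by
    have e1 : q^1 * q'^1 = z := by rw [pow_one, pow_one]
    have e2 : q^3 * q'^1 = (q*q) * z := by
      rw [hz]; simp only [pow_succ, pow_zero, one_mul, mul_assoc]
    have e3 : q^1 * q'^3 = z * (q'*q') := by
      rw [hz]; simp only [pow_succ, pow_zero, one_mul, mul_assoc]
    have e4 : q^2 * q'^2 = (q*q) * (q'*q') := by rw [pow_two, pow_two]
    rw [he, e1, e2, e3, e4]
    refine ((Commute.smul_right ?_ _).add_right (Commute.smul_right ?_ _)).add_right
      (Commute.smul_right ?_ _)
    · exact (c1.mul_right c1).mul_right cz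
    · exact c3.mul_right ((cq2.mul_right cz).add_right (cz.mul_right cq2'))
    · exact c4.mul_right (cq2.mul_right cq2')
  have cc : Commute S c := (c4.mul_right cz).smul_right _
  have cSB : Commute S B := by
    rw [hB, alphaE]
    refine (Commute.smul_right ?_ _).add_right (Commute.smul_right ?_ _)
    · exact (Commute.one_right _).add_right (cu.smul_right _)
    · exact ((Commute.one_right _).add_right (cp.smul_right _)).mul_right
        ((Commute.one_right _).add_right (cp'.smul_right _))
  have cSA : Commute S A := cSB.add_right (cz.smul_right _)
  -- decompositions
  have tB : B - (2*ρ/9) • S = ((1-ρ)/3) • 1 + (2*(1-ρ)/3) • (p*p') + (2*ρ/9) • p + (2*ρ/9) • p'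
      + (ρ/3) • (p*p') := by
    rw [hB, alphaE, hS]
    simp only [smul_mul_assoc, mul_smul_comm, mul_add, add_mul, mul_one, one_mul]
    module
  have tA : A - (2*ρ/9) • S = ((1-ρ)/3) • 1 + (2*(1-ρ)/3) • (p*p'+q*q') + (2*ρ/9) • p + (2*ρ/9) • p'
      + (ρ/3) • (p*p') := by
    have : A = B + (2*(1-ρ)/3) • (q*q') := rfl
    rw [this, add_sub_right_comm, tB]
    module
  have nT : ∀ y : R, ‖y‖ ≤ 1 → ‖((1-ρ)/3) • 1 + (2*(1-ρ)/3) • y + (2*ρ/9) • p + (2*ρ/9) • p'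
      + (ρ/3) • (p*p')‖ ≤ 1 - 2*ρ/9 := by
    intro y hy
    have a1 := nsmul_le' (x := (1:R)) (r := (1-ρ)/3) (by linarith) (by simp)
    have a2 := nsmul_le' (r := 2*(1-ρ)/3) (by linarith) hy
    have a3 := nsmul_le' hE.le Q.h.np
    have a4 := nsmul_le' hE.le Q.h'.np
    have a5 := nsmul_le' (r := ρ/3) (by linarith) Q.nu
    refine (norm_add_le_of_le (norm_add_le_of_le (norm_add_le_of_le (norm_add_le_of_le
      a1 a2) a3) a4) a5).trans (le_of_eq (by ring))
  have nτB : ‖B - (2*ρ/9) • S‖ ≤ 1 - 2*ρ/9 := tB ▸ nT _ Q.nu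
  have nτA : ‖A - (2*ρ/9) • S‖ ≤ 1 - 2*ρ/9 := tA ▸ nT _ Q.nuz
  have dA : A = (2*ρ/9) • S + (A - (2*ρ/9) • S) := by abel
  have dB : B = (2*ρ/9) • S + (B - (2*ρ/9) • S) := by abel
  have cτA : Commute S (A - (2*ρ/9) • S) := cSA.sub_right ((Commute.refl S).smul_right _)
  have cτB : Commute S (B - (2*ρ/9) • S) := cSB.sub_right ((Commute.refl S).smul_right _)
  have nA : ‖A‖ ≤ 1 := by
    rw [dA]
    exact (norm_add_le_of_le (nsmul_le' hE.le Q.nS) nτA).trans (le_of_eq (by ring))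
  have nB : ‖B‖ ≤ 1 := by
    rw [dB]
    exact (norm_add_le_of_le (nsmul_le' hE.le Q.nS) nτB).trans (le_of_eq (by ring))
  obtain ⟨C, hC0, hC⟩ := Q.rem_decay (β*l)
  have hCA : ∀ k : ℕ, ‖A^k * e‖ ≤ (C/(2*ρ/9)^2)/(((k:ℝ)+1)*(k+2)) := by
    intro k
    rw [dA]
    exact (mix_left hE hE1 cτA nτA _ hC k).trans (sum2 hC0 hE hE1 k)
  have hCB : ∀ k : ℕ, ‖e * B^k‖ ≤ (C/(2*ρ/9)^2)/(((k:ℝ)+1)*(k+2)) := by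
    intro k
    rw [dB]
    refine (mix_right hE hE1 cτB nτB _ (fun j => ?_) k).trans (sum2 hC0 hE hE1 k)
    rw [← (ce.pow_left j).eq]
    exact hC j
  have hl0 : 0 ≤ l := by positivity
  have hcS : ∀ j : ℕ, ‖S^j * c‖ ≤ (l*(8*4))/((j:ℝ)+1) := by
    intro j
    have n4 : ‖(p+p') * ((3:ℝ) • 1 - p*p')‖ ≤ 8 := by
      have n3 : ‖(3:ℝ) • (1:R) - p*p'‖ ≤ 4 := by
        have := norm_sub_le ((3:ℝ) • (1:R)) (p*p')
        have := nsmul_le' (x := (1:R)) (r := 3) (by norm_num) (by simp)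
        linarith [Q.nu]
      have h1 := norm_add_le p p'
      have h2 := Q.h.np
      have h3 := Q.h'.np
      have h4 := norm_mul_le (p+p') ((3:ℝ) • 1 - p*p')
      nlinarith [norm_nonneg (p+p'), norm_nonneg ((3:ℝ) • (1:R) - p*p')]
    have h5 := Q.Sdecay1 j
    rw [pow_one, pow_one, ← hS, ← hz] at h5
    rw [hc, mul_smul_comm, norm_smul, Real.norm_of_nonneg hl0, mul_div_assoc, mul_div_assoc]
    refine mul_le_mul_of_nonneg_left ?_ hl0
    rw [← mul_assoc, (c4.pow_left j).eq, mul_assoc]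
    refine (norm_mul_le _ _).trans ?_
    gcongr
  have hcA : ∀ k : ℕ, ‖A^k * c‖ ≤ ((l*(8*4))/(2*ρ/9))/((k:ℝ)+1) := by
    intro k
    rw [dA]
    exact (mix_left hE hE1 cτA nτA _ hcS k).trans (sum1 (by positivity) hE hE1 k)
  have hcB : ∀ k : ℕ, ‖c * B^k‖ ≤ ((l*(8*4))/(2*ρ/9))/((k:ℝ)+1) := by
    intro k
    rw [dB]
    refine (mix_right hE hE1 cτB nτB _ (fun j => ?_) k).trans (sum1 (by positivity) hE hE1 k)
    rw [← (cc.pow_left j).eq]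
    exact hcS j
  have hβ0 : 0 ≤ β := by rw [hβ]; linarith
  have hAB : A - B = β • z := by
    have : A = B + β • z := rfl
    rw [this]; abel
  set D := (l*(8*4))/(2*ρ/9)
  set C' := C/(2*ρ/9)^2
  refine ⟨β * (D + D + 4*C'), fun n => ?_⟩
  have hzz : z = (A * c - c * B) + e := by rw [key]; abel
  have hsum : A^n - B^n = β • (A^n * c - c * B^n + ∑ k ∈ Finset.range n, A^k * e * B^(n-1-k)) := by
    rw [telescope, hAB, telescope', ← Finset.sum_add_distrib, Finset.smul_sum]
    refine Finset.sum_congr rfl fun k _ => ?_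
    rw [mul_smul_comm, smul_mul_assoc, ← add_mul, ← mul_add, ← hzz]
  rw [hsum, norm_smul, Real.norm_of_nonneg hβ0]
  have f1 := norm_add_le_of_le (norm_sub_le_of_le (hcA n) (hcB n)) (sum_small nA nB hCA hCB n)
  refine (mul_le_mul_of_nonneg_left f1 hβ0).trans_eq ?_
  ring

lemma main {ρ : ℝ} (h0 : 0 < ρ) (h1 : ρ < 1) :
    Tendsto (fun n : ℕ => ‖(piE p q p' q' ρ)^n - (sigmaE p p')^n‖) atTop (nhds 0) := by
  obtain ⟨C1, hC1⟩ := Q.step1 h0 h1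
  obtain ⟨C2, hC2⟩ := Q.step2 h0 h1
  have ht : Tendsto (fun n : ℕ => (C1 + C2) * (1/((n:ℝ)+1))) atTop (nhds 0) := by
    simpa using (tendsto_one_div_add_atTop_nhds_zero_nat (𝕜 := ℝ)).const_mul (C1 + C2)
  refine squeeze_zero (fun n => norm_nonneg _) (fun n => ?_) ht
  refine (norm_sub_le_norm_sub_add_norm_sub _ ((alphaE p p' ρ)^n) _).trans ?_
  refine (add_le_add (hC1 n) (hC2 n)).trans_eq ?_
  ring

end Quad

end abstractPart

section concretePart

variable {H : Type*} [Group H]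

/-- The `ℓ¹` norm on the real group algebra. -/
noncomputable def l1N (x : MonoidAlgebra ℝ H) : ℝ := x.coeff.sum fun _ r => |r|

lemma l1N_eq_tsum (x : MonoidAlgebra ℝ H) : l1N x = ∑' g, |x.coeff g| := by
  rw [l1N, Finsupp.sum, tsum_eq_sum]
  intro g hg
  simpa using hg

lemma l1N_summable (x : MonoidAlgebra ℝ H) : Summable fun g => |x.coeff g| :=
  summable_of_ne_finset_zero (s := x.coeff.support) fun g hg => by simpa using hg

lemma l1N_add (x y : MonoidAlgebra ℝ H) : l1N (x + y) ≤ l1N x + l1N y := by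
  rw [l1N_eq_tsum, l1N_eq_tsum, l1N_eq_tsum, ← (l1N_summable x).tsum_add (l1N_summable y)]
  refine (l1N_summable _).tsum_le_tsum (fun g => ?_) ((l1N_summable x).add (l1N_summable y))
  rw [MonoidAlgebra.coeff_add]
  exact abs_add_le _ _

lemma l1N_zero : l1N (0 : MonoidAlgebra ℝ H) = 0 := by
  simp [l1N]

lemma l1N_single (g : H) (r : ℝ) : l1N (MonoidAlgebra.single g r) = |r| := by
  simp [l1N]

lemma l1N_sum {ι : Type*} (s : Finset ι) (f : ι → MonoidAlgebra ℝ H) :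
    l1N (∑ i ∈ s, f i) ≤ ∑ i ∈ s, l1N (f i) :=
  Finset.le_sum_of_subadditive l1N l1N_zero.le l1N_add s f

lemma l1N_mul (x y : MonoidAlgebra ℝ H) : l1N (x * y) ≤ l1N x * l1N y := by
  rw [MonoidAlgebra.mul_def]
  simp only [Finsupp.sum]
  refine (l1N_sum _ _).trans ?_
  rw [l1N, Finsupp.sum, Finset.sum_mul]
  refine Finset.sum_le_sum fun g _ => ?_
  refine (l1N_sum _ _).trans ?_
  rw [l1N, Finsupp.sum, Finset.mul_sum]
  refine Finset.sum_le_sum fun h _ => ?_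
  rw [l1N_single, abs_mul]

lemma l1N_smul (r : ℝ) (x : MonoidAlgebra ℝ H) : l1N (r • x) = |r| * l1N x := by
  rw [l1N_eq_tsum, l1N_eq_tsum, ← tsum_mul_left]
  refine tsum_congr fun g => ?_
  rw [MonoidAlgebra.coeff_smul_apply, smul_eq_mul, abs_mul]

/-- The `ℓ¹` ring norm. -/
noncomputable def l1RN : RingNorm (MonoidAlgebra ℝ H) where
  toFun := l1N
  map_zero' := l1N_zero
  add_le' := l1N_add
  neg' x := by
    rw [← neg_one_smul ℝ x, l1N_smul]; simp
  mul_le' := l1N_mul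
  eq_zero_of_map_eq_zero' x hx := by
    rw [l1N, Finsupp.sum, Finset.sum_eq_zero_iff_of_nonneg (fun _ _ => abs_nonneg _)] at hx
    ext g
    by_cases hg : g ∈ x.coeff.support
    · simpa using hx g hg
    · simpa using hg

noncomputable instance l1NormedRing : NormedRing (MonoidAlgebra ℝ H) := l1RN.toNormedRing

lemma norm_eq_l1N (x : MonoidAlgebra ℝ H) : ‖x‖ = l1N x := rfl

noncomputable instance l1NormedAlgebra : NormedAlgebra ℝ (MonoidAlgebra ℝ H) where
  norm_smul_le r x := by
    rw [norm_eq_l1N, norm_eq_l1N, l1N_smul, Real.norm_eq_abs]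

instance l1NormOne : NormOneClass (MonoidAlgebra ℝ H) where
  norm_one := by
    rw [norm_eq_l1N, MonoidAlgebra.one_def, l1N_single, abs_one]

lemma conv_coeff (x y : MonoidAlgebra ℝ H) :
    conv (fun g => x.coeff g) (fun g => y.coeff g) = fun g => (x * y).coeff g := by
  funext g
  rw [MonoidAlgebra.coeff_mul_apply_left, conv, Finsupp.sum, tsum_eq_sum]
  intro h hh
  simp only [Finsupp.mem_support_iff, not_not] at hh
  rw [hh, zero_mul]

lemma convPow_coeff (x : MonoidAlgebra ℝ H) (n : ℕ) :
    convPow (fun g => x.coeff g) n = fun g => (x^n).coeff g := by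
  induction n with
  | zero =>
    funext g
    classical
    rw [convPow, pow_zero, MonoidAlgebra.one_def, MonoidAlgebra.coeff_single, Finsupp.single_apply,
      Set.indicator_apply]
    simp only [Set.mem_singleton_iff, eq_comm]
  | succ n ih => rw [convPow, ih, conv_coeff, pow_succ']

lemma conv_prodM {f f' g g' : H → ℝ} (hf : f.support.Finite) (hf' : f'.support.Finite) :
    conv (prodM f f') (prodM g g') = prodM (conv f g) (conv f' g') := by
  funext ⟨x, y⟩
  have s1 : Summable fun h => ‖f h * g (h⁻¹ * x)‖ := by
    refine summable_of_finite_support (hf.subset ?_)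
    intro h hh
    simp at hh ⊢
    exact hh.1
  have s2 : Summable fun h => ‖f' h * g' (h⁻¹ * y)‖ := by
    refine summable_of_finite_support (hf'.subset ?_)
    intro h hh
    simp at hh ⊢
    exact hh.1
  simp only [conv, prodM]
  rw [tsum_mul_tsum_of_summable_norm s1 s2]
  refine tsum_congr fun ⟨h, k⟩ => ?_
  simp only [Prod.inv_mk, Prod.mk_mul_mk]
  ring

lemma convPow_prodM {f : H → ℝ} (hf : f.support.Finite) (n : ℕ) :
    convPow (prodM f f) n = prodM (convPow f n) (convPow f n) := by
  induction n with
  | zero =>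
    funext ⟨x, y⟩
    classical
    simp only [convPow, prodM, Set.indicator_apply, Set.mem_singleton_iff, Prod.mk_eq_one]
    by_cases hx : x = 1 <;> by_cases hy : y = 1 <;> simp [hx, hy]
  | succ n ih => rw [convPow, ih, conv_prodM hf hf]; rfl

lemma l1dist_coeff (x y : MonoidAlgebra ℝ H) :
    l1dist (fun g => x.coeff g) (fun g => y.coeff g) = ‖x - y‖ := by
  rw [norm_eq_l1N, l1N_eq_tsum, l1dist]
  rfl

/-- indicator of a point -/
noncomputable def pt {E : Type*} (g x : E) : ℝ := ({g} : Set E).indicator (fun _ => (1:ℝ)) x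

lemma ind_eq {E : Type*} (g x : E) (r : ℝ) :
    ({g} : Set E).indicator (fun _ => r) x = r * pt g x := by
  classical
  simp [pt, Set.indicator_apply]

lemma coeff_single_pt (g : H) (r : ℝ) (x : H) :
    (MonoidAlgebra.single g r).coeff x = r * pt g x := by
  classical
  rw [MonoidAlgebra.coeff_single, Finsupp.single_apply, pt, Set.indicator_apply]
  simp [eq_comm]

lemma pt_prod (g h x y : H) : pt (g, h) (x, y) = pt g x * pt h y := by
  classical
  by_cases hx : x = g <;> by_cases hy : y = h <;> simp [pt, hx, hy]

lemma Da_sq : Da * Da = 1 := by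
  have : (PresentedGroup.mk dihedralRels (FreeGroup.of 0 ^ 2)) = 1 :=
    PresentedGroup.one_of_mem (by simp [dihedralRels])
  rw [map_pow, pow_two] at this
  exact this

lemma Db_sq : Db * Db = 1 := by
  have : (PresentedGroup.mk dihedralRels (FreeGroup.of 1 ^ 2)) = 1 :=
    PresentedGroup.one_of_mem (by simp [dihedralRels])
  rw [map_pow, pow_two] at this
  exact this

lemma muLazy_eq (x : DInf) : muLazy x = (1/3) * (pt 1 x + pt Da x + pt Db x) := by
  simp only [muLazy, ind_eq]; ring

lemma muLazy_fin : (muLazy.support).Finite := by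
  refine Set.Finite.subset (s := {1, Da, Db}) (by simp) ?_
  intro x hx
  by_contra h
  simp only [Set.mem_insert_iff, Set.mem_singleton_iff, not_or] at h
  apply hx
  simp [muLazy, h.1, h.2.1, h.2.2]

lemma diag_eq_pt {E : Type*} (g x : E) : pt g x = pt g x * pt g x := by
  classical
  by_cases hx : x = g <;> simp [pt, hx]

lemma diag_ne_pt {E : Type*} (g x y : E) (h : x ≠ y) : pt g x * pt g y = 0 := by
  classical
  by_cases hx : x = g
  · have hy : y ≠ g := fun hy => h (hx.trans hy.symm)
    simp [pt, hy]
  · simp [pt, hx]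

lemma diagM_eq (x y : DInf) :
    diagM muLazy (x, y) = (1/3) * (pt 1 x * pt 1 y + pt Da x * pt Da y + pt Db x * pt Db y) := by
  classical
  by_cases h : x = y
  · subst h
    rw [← diag_eq_pt, ← diag_eq_pt, ← diag_eq_pt]
    simp [diagM, muLazy_eq]
    try ring
  · rw [diag_ne_pt _ _ _ h, diag_ne_pt _ _ _ h, diag_ne_pt _ _ _ h]
    simp [diagM, h]

end concretePart

/-- Generators of the group algebra. -/
noncomputable def gE (g : DInf × DInf) : MonoidAlgebra ℝ (DInf × DInf) := MonoidAlgebra.single g 1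

lemma gE_mul (g h : DInf × DInf) : gE g * gE h = gE (g * h) := by
  simp [gE, MonoidAlgebra.single_mul_single]

lemma gE_one : gE 1 = 1 := rfl

lemma gE_norm (g : DInf × DInf) : ‖gE g‖ ≤ 1 := by
  rw [norm_eq_l1N, gE, l1N_single, abs_one]

lemma gE_coeff (g h x y : DInf) : (gE (g, h)).coeff (x, y) = pt g x * pt h y := by
  rw [gE, coeff_single_pt, one_mul, pt_prod]

/-- The four elements. -/
noncomputable def eP : MonoidAlgebra ℝ (DInf × DInf) := ((1:ℝ)/2) • (gE (Da, 1) + gE (Db, 1))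
/-- antisymmetric part, first coordinate -/
noncomputable def eQ : MonoidAlgebra ℝ (DInf × DInf) := ((1:ℝ)/2) • (gE (Da, 1) - gE (Db, 1))
/-- symmetric part, second coordinate -/
noncomputable def eP' : MonoidAlgebra ℝ (DInf × DInf) := ((1:ℝ)/2) • (gE (1, Da) + gE (1, Db))
/-- antisymmetric part, second coordinate -/
noncomputable def eQ' : MonoidAlgebra ℝ (DInf × DInf) := ((1:ℝ)/2) • (gE (1, Da) - gE (1, Db))

lemma gE_comm (g h : DInf) : Commute (gE (g, 1)) (gE (1, h)) := by
  rw [Commute, SemiconjBy, gE_mul, gE_mul]; simp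

lemma quad : Quad eP eQ eP' eQ' where
  h := half_of_inv (by rw [gE_mul, Prod.mk_mul_mk, Da_sq, one_mul]; rfl)
    (by rw [gE_mul, Prod.mk_mul_mk, Db_sq, one_mul]; rfl) (gE_norm _) (gE_norm _)
  h' := half_of_inv (by rw [gE_mul, Prod.mk_mul_mk, Da_sq, one_mul]; rfl)
    (by rw [gE_mul, Prod.mk_mul_mk, Db_sq, one_mul]; rfl) (gE_norm _) (gE_norm _)
  cpp := ((((gE_comm _ _).add_right (gE_comm _ _)).add_left
    ((gE_comm _ _).add_right (gE_comm _ _))).smul_left _).smul_right _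
  cpq := ((((gE_comm _ _).sub_right (gE_comm _ _)).add_left
    ((gE_comm _ _).sub_right (gE_comm _ _))).smul_left _).smul_right _
  cqp := ((((gE_comm _ _).add_right (gE_comm _ _)).sub_left
    ((gE_comm _ _).add_right (gE_comm _ _))).smul_left _).smul_right _
  cqq := ((((gE_comm _ _).sub_right (gE_comm _ _)).sub_left
    ((gE_comm _ _).sub_right (gE_comm _ _))).smul_left _).smul_right _
  nuz := by
    have : eP * eP' + eQ * eQ' = ((1:ℝ)/2) • (gE (Da, Da)) + ((1:ℝ)/2) • gE (Db, Db) := by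
      simp only [eP, eP', eQ, eQ', smul_mul_assoc, mul_smul_comm, mul_add, add_mul, mul_sub,
        sub_mul, gE_mul, Prod.mk_mul_mk, one_mul, mul_one]
      module
    rw [this]
    refine (norm_add_le_of_le (nsmul_le' (by norm_num) (gE_norm _))
      (nsmul_le' (by norm_num) (gE_norm _))).trans (le_of_eq (by norm_num))

lemma sigma_coeff : prodM muLazy muLazy = fun g => (sigmaE eP eP').coeff g := by
  funext ⟨x, y⟩
  have : sigmaE eP eP' = ((1:ℝ)/9) • (gE (1,1) + gE (Da,1) + gE (Db,1) + gE (1,Da) + gE (1,Db)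
      + gE (Da,Da) + gE (Da,Db) + gE (Db,Da) + gE (Db,Db)) := by
    rw [sigmaE, ← gE_one, Prod.one_eq_mk]
    simp only [eP, eP', smul_mul_assoc, mul_smul_comm, mul_add, add_mul, gE_mul, Prod.mk_mul_mk,
      one_mul, mul_one]
    module
  rw [this]
  simp only [MonoidAlgebra.coeff_smul_apply, MonoidAlgebra.coeff_add, Finsupp.add_apply, gE_coeff,
    prodM, muLazy_eq, smul_eq_mul]
  ring

lemma noise_coeff (ρ : ℝ) : noise muLazy ρ = fun g => (piE eP eQ eP' eQ' ρ).coeff g := by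
  funext ⟨x, y⟩
  have : piE eP eQ eP' eQ' ρ = ((1-ρ)/3) • (gE (1,1) + gE (Da,Da) + gE (Db,Db))
      + ρ • sigmaE eP eP' := by
    rw [piE, alphaE, sigmaE, ← gE_one, Prod.one_eq_mk]
    simp only [eP, eP', eQ, eQ', smul_mul_assoc, mul_smul_comm, mul_add, add_mul, mul_sub, sub_mul,
      gE_mul, Prod.mk_mul_mk, one_mul, mul_one]
    module
  rw [this]
  simp only [MonoidAlgebra.coeff_smul_apply, MonoidAlgebra.coeff_add, Finsupp.add_apply, gE_coeff,
    smul_eq_mul, noise, diagM_eq, sigma_coeff]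
  ring

/-- The lazy simple random walk on the infinite dihedral
group is `ℓ¹`-noise sensitive. -/
theorem dihedral_lazy_l1NS :
    ∀ ρ ∈ Set.Ioo (0 : ℝ) 1,
      Tendsto
        (fun n => l1dist (convPow (noise muLazy ρ) n)
          (prodM (convPow muLazy n) (convPow muLazy n)))
        atTop (nhds 0) := by
  rintro ρ ⟨h0, h1⟩
  have h := quad.main h0 h1
  refine h.congr fun n => ?_
  rw [← convPow_prodM muLazy_fin, noise_coeff, sigma_coeff, convPow_coeff, convPow_coeff,
    l1dist_coeff]

end NS
end
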